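/- For ν > 0 and z > 0, the order derivative of the Bessel function J satisfies ∂J_ν(z)/∂ν = νπ Y_ν(z) ∫₀^z J_ν(t)²/t dt + νπ J_ν(z) ∫_z^∞ J_ν(t) Y_ν(t)/t dt. -/

import Mathlib

open MeasureTheory Real Filter Set Topology

noncomputable def besselJ (ν x : ℝ) : ℝ :=
  (x / 2) ^ ν * ∑' k : ℕ, (-1 : ℝ) ^ k * (x ^ 2 / 4) ^ k / (k.factorial * Real.Gamma (ν + k + 1))

noncomputable def besselY (ν x : ℝ) : ℝ :=
  limUnder (𝓝[{μ : ℝ | ∀ n : ℤ, μ ≠ (n : ℝ)}] ν)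
    (fun μ => (besselJ μ x * Real.cos (μ * Real.pi) - besselJ (-μ) x) / Real.sin (μ * Real.pi))

theorem exists_norm_one_div_Gamma_add_nat_le (R : ℝ) :
    ∃ C, 0 ≤ C ∧ ∀ (s : ℂ), ‖s‖ ≤ R → ∀ k : ℕ, ‖(Complex.Gamma (s + k + 1))⁻¹‖ ≤ C := by
  obtain ⟨m, hm⟩ := exists_nat_ge (R + 1)
  obtain ⟨C, hC⟩ := (isCompact_closedBall (0 : ℂ) (R + m + 1)).exists_bound_of_continuousOn
    Complex.differentiable_one_div_Gamma.continuous.continuousOn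
  have small : ∀ s : ℂ, ‖s‖ ≤ R → ∀ k : ℕ, k ≤ m → ‖(Complex.Gamma (s + k + 1))⁻¹‖ ≤ C := by
    intro s hs k hk
    apply hC
    rw [mem_closedBall_zero_iff]
    have h1 := norm_add₃_le (a := s) (b := (k : ℂ)) (c := 1)
    have h2 : (k : ℝ) ≤ m := by exact_mod_cast hk
    simp only [Complex.norm_natCast, norm_one] at h1
    linarith
  refine ⟨max C 0, le_max_right _ _, fun s hs k => ?_⟩
  refine le_trans ?_ (le_max_left _ _)
  induction k with
  | zero => exact small s hs 0 (Nat.zero_le _)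
  | succ k ih =>
    rcases le_total (k + 1) m with h | h
    · exact small s hs _ h
    · refine le_trans ?_ ih
      rw [Complex.one_div_Gamma_eq_self_mul_one_div_Gamma_add_one (s + k + 1), norm_mul]
      have h2 : (m : ℝ) ≤ k + 1 := by exact_mod_cast h
      have h1 : 1 ≤ ‖s + k + 1‖ := by
        have h3 := norm_sub_norm_le ((k : ℂ) + 1) (-s)
        have h4 : ‖(k : ℂ) + 1‖ = k + 1 := by
          exact_mod_cast Complex.norm_natCast (k + 1)
        rw [norm_neg, h4, show (k : ℂ) + 1 - -s = s + k + 1 by ring] at h3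
        linarith
      have h5 : s + (↑(k + 1) : ℂ) + 1 = s + k + 1 + 1 := by push_cast; ring
      rw [h5]
      exact le_mul_of_one_le_left (norm_nonneg _) h1

/-- The `k`-th term of the entire part of the Bessel function, as a function of a complex order. -/
noncomputable def besselTerm (k : ℕ) (y : ℝ) (s : ℂ) : ℂ :=
  (((-1 : ℝ) ^ k * y ^ k / k.factorial : ℝ) : ℂ) * (Complex.Gamma (s + k + 1))⁻¹

/-- The entire part of the Bessel function: `J_ν(x) = (x/2)^ν S(ν, x²/4)`. -/
noncomputable def besselS (ν y : ℝ) : ℝ :=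
  ∑' k : ℕ, (-1 : ℝ) ^ k * y ^ k / (k.factorial * Real.Gamma (ν + k + 1))

theorem besselJ_eq (ν x : ℝ) : besselJ ν x = (x / 2) ^ ν * besselS ν (x ^ 2 / 4) := rfl

theorem besselTerm_ofReal (k : ℕ) (y ν : ℝ) :
    besselTerm k y ν =
      (((-1 : ℝ) ^ k * y ^ k / (k.factorial * Real.Gamma (ν + k + 1)) : ℝ) : ℂ) := by
  have : (ν : ℂ) + k + 1 = ((ν + k + 1 : ℝ) : ℂ) := by push_cast; ring
  rw [besselTerm, this, Complex.Gamma_ofReal, ← Complex.ofReal_inv, ← Complex.ofReal_mul]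
  congr 1
  rw [div_mul_eq_div_div, div_eq_mul_inv _ (Real.Gamma _)]

theorem norm_besselTerm_le {R C : ℝ}
    (hC : ∀ s : ℂ, ‖s‖ ≤ R → ∀ k : ℕ, ‖(Complex.Gamma (s + k + 1))⁻¹‖ ≤ C)
    {r y : ℝ} (hy : |y| ≤ r) (k : ℕ) {s : ℂ} (hs : ‖s‖ ≤ R) :
    ‖besselTerm k y s‖ ≤ C * (r ^ k / k.factorial) := by
  have h0 : ‖(((-1 : ℝ) ^ k * y ^ k / k.factorial : ℝ) : ℂ)‖ ≤ r ^ k / k.factorial := by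
    rw [Complex.norm_real, norm_div, norm_mul, norm_pow, norm_pow, norm_neg, norm_one, one_pow,
      one_mul, Real.norm_eq_abs, Real.norm_of_nonneg (Nat.cast_nonneg _)]
    gcongr
  rw [besselTerm, norm_mul, mul_comm]
  exact mul_le_mul (hC s hs k) h0 (norm_nonneg _) ((norm_nonneg _).trans (hC s hs 0))

theorem differentiable_tsum_besselTerm (y : ℝ) :
    Differentiable ℂ fun s => ∑' k : ℕ, besselTerm k y s := by
  intro s
  obtain ⟨C, hC0, hC⟩ := exists_norm_one_div_Gamma_add_nat_le (‖s‖ + 1)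
  have hd : DifferentiableOn ℂ (fun s => ∑' k : ℕ, besselTerm k y s) (Metric.ball 0 (‖s‖ + 1)) := by
    refine Complex.differentiableOn_tsum_of_summable_norm
      ((Real.summable_pow_div_factorial |y|).mul_left C) (fun k => ?_) Metric.isOpen_ball
      (fun k w hw => norm_besselTerm_le hC le_rfl k (mem_ball_zero_iff.1 hw).le)
    have : Differentiable ℂ fun s : ℂ => (Complex.Gamma (s + k + 1))⁻¹ :=
      Complex.differentiable_one_div_Gamma.comp
        ((differentiable_id.add_const (k : ℂ)).add_const (1 : ℂ))
    exact (this.const_mul _).differentiableOn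
  exact hd.differentiableAt (Metric.isOpen_ball.mem_nhds (by simp))

theorem differentiable_besselS_order (y : ℝ) : Differentiable ℝ fun ν => besselS ν y := by
  intro ν
  have h := ((differentiable_tsum_besselTerm y) ν).hasDerivAt.real_of_complex
  refine h.differentiableAt.congr_of_eventuallyEq (Eventually.of_forall fun μ => ?_)
  simp only [besselTerm_ofReal, ← Complex.ofReal_tsum, Complex.ofReal_re, besselS]

theorem exists_abs_besselS_le (R r : ℝ) :
    ∃ C, 0 ≤ C ∧ ∀ ν y : ℝ, |ν| ≤ R → |y| ≤ r → |besselS ν y| ≤ C := by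
  obtain ⟨C, hC0, hC⟩ := exists_norm_one_div_Gamma_add_nat_le R
  have hs := (Real.summable_pow_div_factorial |r|).mul_left C
  refine ⟨∑' k : ℕ, C * (|r| ^ k / k.factorial), tsum_nonneg fun k => by positivity,
    fun ν y hν hy => ?_⟩
  refine tsum_of_norm_bounded (f := fun k : ℕ =>
    (-1 : ℝ) ^ k * y ^ k / (k.factorial * Real.Gamma (ν + k + 1))) hs.hasSum fun k => ?_
  rw [← Complex.norm_real, ← besselTerm_ofReal]
  exact norm_besselTerm_le hC (hy.trans (le_abs_self r)) k (by simpa using hν)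

theorem summable_besselS (ν y : ℝ) : Summable fun k : ℕ =>
    (-1 : ℝ) ^ k * y ^ k / (k.factorial * Real.Gamma (ν + k + 1)) := by
  obtain ⟨C, hC0, hC⟩ := exists_norm_one_div_Gamma_add_nat_le |ν|
  refine Summable.of_norm_bounded ((Real.summable_pow_div_factorial |y|).mul_left C) fun k => ?_
  rw [← Complex.norm_real, ← besselTerm_ofReal]
  exact norm_besselTerm_le hC le_rfl k (by simp)

theorem deriv_besselS_term_succ (ν y : ℝ) (k : ℕ) :
    (-1 : ℝ) ^ (k + 1) * (((k + 1 : ℕ) : ℝ) * y ^ (k + 1 - 1)) /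
      ((k + 1).factorial * Real.Gamma (ν + ((k + 1 : ℕ) : ℝ) + 1)) =
    -((-1 : ℝ) ^ k * y ^ k / (k.factorial * Real.Gamma (ν + 1 + k + 1))) := by
  have h1 : ν + ((k + 1 : ℕ) : ℝ) + 1 = ν + 1 + k + 1 := by push_cast; ring
  have h2 : ((k + 1 : ℕ) : ℝ) ≠ 0 := by positivity
  rw [h1, Nat.factorial_succ, Nat.add_sub_cancel, Nat.cast_mul, mul_assoc ((k + 1 : ℕ) : ℝ),
    show (-1 : ℝ) ^ (k + 1) * (((k + 1 : ℕ) : ℝ) * y ^ k) =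
      ((k + 1 : ℕ) : ℝ) * (-((-1) ^ k * y ^ k)) by ring, mul_div_mul_left _ _ h2, neg_div]

theorem hasDerivAt_besselS (ν y : ℝ) :
    HasDerivAt (fun y => besselS ν y) (-besselS (ν + 1) y) y := by
  obtain ⟨C, hC0, hC⟩ := exists_norm_one_div_Gamma_add_nat_le |ν + 1|
  set r := |y| + 1
  have hr : 0 ≤ r := by positivity
  have h := hasDerivAt_tsum_of_isPreconnected (𝕜 := ℝ) (F := ℝ) (t := Metric.ball 0 r) (y := y)
    (y₀ := y)
    (g := fun (k : ℕ) y => (-1 : ℝ) ^ k * y ^ k / (k.factorial * Real.Gamma (ν + k + 1)))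
    (g' := fun (k : ℕ) y =>
      (-1 : ℝ) ^ k * (k * y ^ (k - 1)) / (k.factorial * Real.Gamma (ν + k + 1)))
    (u := fun k : ℕ => C * (r ^ (k - 1) / ((k - 1).factorial : ℝ))) ?_ Metric.isOpen_ball
    (convex_ball _ _).isPreconnected ?_ ?_ (by simp [r]) (summable_besselS ν y) (by simp [r])
  · refine h.congr_deriv ?_
    set f : ℕ → ℝ := fun k =>
      (-1 : ℝ) ^ k * (k * y ^ (k - 1)) / (k.factorial * Real.Gamma (ν + k + 1)) with hf
    have h1 : ∀ k, f (k + 1) =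
        -((-1 : ℝ) ^ k * y ^ k / (k.factorial * Real.Gamma (ν + 1 + k + 1))) :=
      deriv_besselS_term_succ ν y
    have h2 : HasSum (fun k => f (k + 1)) (-besselS (ν + 1) y) := by
      simp only [h1]
      exact (summable_besselS (ν + 1) y).hasSum.neg
    rw [((hasSum_nat_add_iff 1).1 h2).tsum_eq]
    simp [hf]
  · exact (summable_nat_add_iff (f := fun k : ℕ => C * (r ^ (k - 1) / ((k - 1).factorial : ℝ))) 1).1
      ((Real.summable_pow_div_factorial r).mul_left C)
  · intro k y _
    exact ((hasDerivAt_pow k y).const_mul _).div_const _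
  · intro k x hx
    have hx' : |x| ≤ r := (mem_ball_zero_iff.1 hx).le
    rcases k with _ | k
    · simpa using by positivity
    · rw [deriv_besselS_term_succ, norm_neg, ← Complex.norm_real, ← besselTerm_ofReal]
      exact norm_besselTerm_le hC hx' k (Complex.norm_real (ν + 1)).le

theorem besselS_sub_one (ν y : ℝ) :
    besselS (ν - 1) y = ν * besselS ν y - y * besselS (ν + 1) y := by
  set f : ℕ → ℝ := fun k =>
    (-1 : ℝ) ^ k * (k * y ^ (k - 1)) / (k.factorial * Real.Gamma (ν + k + 1)) with hf
  have h1 : ∀ k, f (k + 1) =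
      -((-1 : ℝ) ^ k * y ^ k / (k.factorial * Real.Gamma (ν + 1 + k + 1))) :=
    deriv_besselS_term_succ ν y
  have h2 : HasSum (fun k => f (k + 1)) (-besselS (ν + 1) y) := by
    simp only [h1]
    exact (summable_besselS (ν + 1) y).hasSum.neg
  have h3 := ((summable_besselS ν y).hasSum.mul_left ν).add
    (((hasSum_nat_add_iff 1).1 h2).mul_left y)
  have h4 : besselS (ν - 1) y =
      ∑' k : ℕ,
        (ν * ((-1 : ℝ) ^ k * y ^ k / (k.factorial * Real.Gamma (ν + k + 1))) + y * f k) := by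
    refine tsum_congr fun k => ?_
    have h5 : (Real.Gamma (ν + k))⁻¹ = (ν + k) * (Real.Gamma (ν + k + 1))⁻¹ := by
      have := Complex.one_div_Gamma_eq_self_mul_one_div_Gamma_add_one ((ν + k : ℝ) : ℂ)
      rw [← Complex.ofReal_one, ← Complex.ofReal_add, Complex.Gamma_ofReal, Complex.Gamma_ofReal]
        at this
      exact_mod_cast this
    have h6 : y * (k * y ^ (k - 1)) = k * y ^ k := by
      rcases k with _ | k
      · simp
      · simp only [Nat.add_sub_cancel]; ring
    have h7 : ν - 1 + k + 1 = ν + k := by ring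
    simp only [hf, h7, div_eq_mul_inv, mul_inv, h5]
    linear_combination (-(-1) ^ k * (k.factorial : ℝ)⁻¹ * (Real.Gamma (ν + k + 1))⁻¹) * h6
  rw [h4, h3.tsum_eq]
  simp only [besselS, hf]
  simp
  ring

theorem besselJ_add_sub {x : ℝ} (hx : 0 < x) (ν : ℝ) :
    besselJ (ν - 1) x + besselJ (ν + 1) x = 2 * ν / x * besselJ ν x := by
  simp only [besselJ_eq, besselS_sub_one]
  rw [Real.rpow_sub_one (by positivity), Real.rpow_add_one (by positivity)]
  field_simp
  ring

theorem hasDerivAt_besselJ {x : ℝ} (hx : 0 < x) (ν : ℝ) :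
    HasDerivAt (besselJ ν) (ν / x * besselJ ν x - besselJ (ν + 1) x) x := by
  have h1 : HasDerivAt (fun x : ℝ => (x / 2) ^ ν) (1 / 2 * ν * (x / 2) ^ (ν - 1)) x := by
    exact ((hasDerivAt_id x).div_const 2).rpow_const (Or.inl (by simp; positivity))
  have h2 : HasDerivAt (fun x : ℝ => x ^ 2 / 4) (x / 2) x := by
    refine ((hasDerivAt_pow 2 x).div_const 4).congr_deriv ?_
    norm_num; ring
  have h3 : HasDerivAt (fun x => besselS ν (x ^ 2 / 4))
      (-besselS (ν + 1) (x ^ 2 / 4) * (x / 2)) x :=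
    HasDerivAt.comp (h₂ := besselS ν) x (hasDerivAt_besselS ν (x ^ 2 / 4)) h2
  refine (h1.mul h3).congr_deriv ?_
  simp only [besselJ_eq]
  rw [Real.rpow_sub_one (by positivity), Real.rpow_add_one (by positivity)]
  field_simp
  ring

theorem hasDerivAt_besselJ' {x : ℝ} (hx : 0 < x) (ν : ℝ) :
    HasDerivAt (besselJ ν) (besselJ (ν - 1) x - ν / x * besselJ ν x) x := by
  refine (hasDerivAt_besselJ hx ν).congr_deriv ?_
  linear_combination -besselJ_add_sub hx ν

theorem differentiable_besselJ_order {x : ℝ} (hx : 0 < x) :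
    Differentiable ℝ fun ν => besselJ ν x := by
  refine Differentiable.mul (fun ν => ?_) (differentiable_besselS_order _)
  exact ((hasDerivAt_id ν).const_rpow (by positivity : 0 < x / 2)).differentiableAt

theorem exists_abs_besselJ_le (R z : ℝ) :
    ∃ C, 0 ≤ C ∧ ∀ ν x : ℝ, |ν| ≤ R → 0 < x → x ≤ z → |besselJ ν x| ≤ C * x ^ ν := by
  obtain ⟨C, hC0, hC⟩ := exists_abs_besselS_le R (z ^ 2 / 4)
  refine ⟨2 ^ R * C, by positivity, fun ν x hν hx hxz => ?_⟩
  have h1 : |besselS ν (x ^ 2 / 4)| ≤ C := by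
    apply hC _ _ hν
    rw [abs_of_nonneg (by positivity)]
    gcongr
  have h2 : (2 : ℝ) ^ (-ν) ≤ 2 ^ R :=
    Real.rpow_le_rpow_of_exponent_le one_le_two ((neg_le_abs ν).trans hν)
  rw [besselJ_eq, abs_mul, abs_of_nonneg (by positivity), Real.div_rpow hx.le zero_le_two,
    div_eq_mul_inv, ← Real.rpow_neg zero_le_two]
  calc x ^ ν * 2 ^ (-ν) * |besselS ν (x ^ 2 / 4)| ≤ x ^ ν * 2 ^ R * C := by gcongr
    _ = _ := by ring

theorem hasDerivAt_const_div (K : ℝ) {t : ℝ} (ht : t ≠ 0) :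
    HasDerivAt (fun t : ℝ => K / t) (-K / t ^ 2) t := by
  simpa [div_eq_mul_inv] using ((hasDerivAt_inv ht).const_mul K)

/-- `u` solves the normal form `u'' + (1 - κ / t²) u = 0` of Bessel's equation on `(0, ∞)`, with
derivative `u'`. -/
def IsNormalSol (κ : ℝ) (u u' : ℝ → ℝ) : Prop :=
  ∀ t, 0 < t → HasDerivAt u (u' t) t ∧ HasDerivAt u' (-(1 - κ / t ^ 2) * u t) t

/-- The solution `u` with its free oscillation removed; its limit at infinity is the complex
amplitude of `u`. -/
noncomputable def wave (u u' : ℝ → ℝ) (t : ℝ) : ℂ :=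
  (u' t + u t * Complex.I) * Complex.exp (-(t * Complex.I))

theorem normSq_wave (u u' : ℝ → ℝ) (t : ℝ) : ‖wave u u' t‖ ^ 2 = u' t ^ 2 + u t ^ 2 := by
  have h : ‖Complex.exp (-(t * Complex.I))‖ = 1 := by
    rw [← neg_mul, ← Complex.ofReal_neg]; exact Complex.norm_exp_ofReal_mul_I _
  rw [wave, norm_mul, h, mul_one, ← Complex.normSq_eq_norm_sq, Complex.normSq_add_mul_I]

theorem wronskian_eq_wave (u u' v v' : ℝ → ℝ) (t : ℝ) :
    u' t * v t - u t * v' t = -((starRingEnd ℂ) (wave v v' t) * wave u u' t).im := by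
  have h :
      (starRingEnd ℂ) (Complex.exp (-(t * Complex.I))) * Complex.exp (-(t * Complex.I)) = 1 := by
    rw [← Complex.exp_conj, ← Complex.exp_add]
    simp
  have h2 : (starRingEnd ℂ) (wave v v' t) * wave u u' t =
      (starRingEnd ℂ) (v' t + v t * Complex.I) * (u' t + u t * Complex.I) := by
    simp only [wave, map_mul]
    linear_combination (starRingEnd ℂ) (v' t + v t * Complex.I) * (u' t + u t * Complex.I) * h
  rw [h2]
  simp
  ring

namespace IsNormalSol

variable {κ : ℝ} {u u' v v' : ℝ → ℝ}

theorem smul (hu : IsNormalSol κ u u') (c : ℝ) :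
    IsNormalSol κ (fun t => c * u t) (fun t => c * u' t) := fun t ht =>
  ⟨(hu t ht).1.const_mul c, ((hu t ht).2.const_mul c).congr_deriv (by ring)⟩

theorem sub (hu : IsNormalSol κ u u') (hv : IsNormalSol κ v v') :
    IsNormalSol κ (fun t => u t - v t) (fun t => u' t - v' t) := fun t ht =>
  ⟨(hu t ht).1.sub (hv t ht).1, ((hu t ht).2.sub (hv t ht).2).congr_deriv (by ring)⟩

theorem hasDerivAt_wronskian {κ' : ℝ} (hu : IsNormalSol κ u u') (hv : IsNormalSol κ' v v') {t : ℝ}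
    (ht : 0 < t) :
    HasDerivAt (fun t => u' t * v t - u t * v' t) ((κ - κ') * (u t * v t / t ^ 2)) t := by
  refine (((hu t ht).2.mul (hv t ht).1).sub ((hu t ht).1.mul (hv t ht).2)).congr_deriv ?_
  ring

theorem hasDerivAt_energy (hu : IsNormalSol κ u u') {t : ℝ} (ht : 0 < t) :
    HasDerivAt (fun t => u' t ^ 2 + u t ^ 2) (2 * κ * (u t * u' t) / t ^ 2) t := by
  refine (((hu t ht).2.pow 2).add ((hu t ht).1.pow 2)).congr_deriv ?_
  simp
  ring

theorem hasDerivAt_energy_mul_exp (hu : IsNormalSol κ u u') (K : ℝ) {t : ℝ} (ht : 0 < t) :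
    HasDerivAt (fun t => (u' t ^ 2 + u t ^ 2) * Real.exp (K / t))
      (Real.exp (K / t) / t ^ 2 * (2 * κ * (u t * u' t) - K * (u' t ^ 2 + u t ^ 2))) t := by
  refine ((hu.hasDerivAt_energy ht).mul (hasDerivAt_const_div K ht.ne').exp).congr_deriv ?_
  ring

theorem antitoneOn_energy_mul_exp (hu : IsNormalSol κ u u') :
    AntitoneOn (fun t => (u' t ^ 2 + u t ^ 2) * Real.exp (|κ| / t)) (Ioi 0) := by
  refine antitoneOn_of_deriv_nonpos (convex_Ioi 0)
    (fun t ht => (hu.hasDerivAt_energy_mul_exp _ ht).continuousAt.continuousWithinAt)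
    (fun t ht => ?_) (fun t ht => ?_) <;> rw [interior_Ioi] at ht
  · exact (hu.hasDerivAt_energy_mul_exp _ ht).differentiableAt.differentiableWithinAt
  · rw [(hu.hasDerivAt_energy_mul_exp _ ht).deriv]
    refine mul_nonpos_of_nonneg_of_nonpos (by positivity) ?_
    rcases abs_cases κ with ⟨h, h'⟩ | ⟨h, h'⟩ <;> rw [h] <;>
      nlinarith [sq_nonneg (u t - u' t), sq_nonneg (u t + u' t)]

theorem monotoneOn_energy_mul_exp (hu : IsNormalSol κ u u') :
    MonotoneOn (fun t => (u' t ^ 2 + u t ^ 2) * Real.exp (-|κ| / t)) (Ioi 0) := by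
  refine monotoneOn_of_deriv_nonneg (convex_Ioi 0)
    (fun t ht => (hu.hasDerivAt_energy_mul_exp _ ht).continuousAt.continuousWithinAt)
    (fun t ht => ?_) (fun t ht => ?_) <;> rw [interior_Ioi] at ht
  · exact (hu.hasDerivAt_energy_mul_exp _ ht).differentiableAt.differentiableWithinAt
  · rw [(hu.hasDerivAt_energy_mul_exp _ ht).deriv]
    refine mul_nonneg (by positivity) ?_
    rcases abs_cases κ with ⟨h, h'⟩ | ⟨h, h'⟩ <;> rw [h] <;>
      nlinarith [sq_nonneg (u t - u' t), sq_nonneg (u t + u' t)]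

theorem exists_abs_le (hu : IsNormalSol κ u u') {T : ℝ} (hT : 0 < T) :
    ∃ C, ∀ t, T ≤ t → |u t| ≤ C := by
  refine ⟨√((u' T ^ 2 + u T ^ 2) * Real.exp (|κ| / T)), fun t ht => Real.abs_le_sqrt ?_⟩
  have ht0 : 0 < t := hT.trans_le ht
  have h := hu.antitoneOn_energy_mul_exp (mem_Ioi.2 hT) (mem_Ioi.2 ht0) ht
  refine le_trans ?_ h
  have h1 : 1 ≤ Real.exp (|κ| / t) := Real.one_le_exp (by positivity)
  nlinarith [sq_nonneg (u t), sq_nonneg (u' t)]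

theorem sq_le_of_tendsto_wave (hu : IsNormalSol κ u u') {w : ℂ}
    (hw : Tendsto (wave u u') atTop (𝓝 w)) {t : ℝ} (ht : 0 < t) :
    u t ^ 2 ≤ ‖w‖ ^ 2 * Real.exp (|κ| / t) := by
  have h1 : Tendsto (fun t => (u' t ^ 2 + u t ^ 2) * Real.exp (-|κ| / t)) atTop
      (𝓝 (‖w‖ ^ 2 * Real.exp 0)) := by
    simp only [← normSq_wave]
    exact (hw.norm.pow 2).mul
      ((Real.continuous_exp.tendsto 0).comp (tendsto_const_nhds.div_atTop tendsto_id))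
  have h2 : (u' t ^ 2 + u t ^ 2) * Real.exp (-|κ| / t) ≤ ‖w‖ ^ 2 * Real.exp 0 :=
    ge_of_tendsto h1 ((eventually_ge_atTop t).mono fun s hs =>
      hu.monotoneOn_energy_mul_exp (mem_Ioi.2 ht) (mem_Ioi.2 (ht.trans_le hs)) hs)
  rw [Real.exp_zero, mul_one, neg_div, Real.exp_neg, ← div_eq_mul_inv,
    div_le_iff₀ (Real.exp_pos _)] at h2
  nlinarith [sq_nonneg (u' t)]

theorem hasDerivAt_wave (hu : IsNormalSol κ u u') {t : ℝ} (ht : 0 < t) :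
    HasDerivAt (wave u u') ((κ * u t / t ^ 2 : ℝ) * Complex.exp (-(t * Complex.I))) t := by
  have h1 : HasDerivAt (fun t : ℝ => -((t : ℂ) * Complex.I)) (-Complex.I) t := by
    have := ((hasDerivAt_id t).ofReal_comp.mul_const Complex.I).neg
    rw [Complex.ofReal_one, one_mul] at this
    exact this
  have h2 := (hu t ht).2.ofReal_comp.add ((hu t ht).1.ofReal_comp.mul_const Complex.I)
  refine (h2.mul h1.cexp).congr_deriv ?_
  simp only [Pi.add_apply]
  push_cast
  linear_combination (-u t * Complex.exp (-(t * Complex.I))) * Complex.I_sq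

theorem exists_tendsto_wave (hu : IsNormalSol κ u u') :
    ∃ w, Tendsto (wave u u') atTop (𝓝 w) := by
  obtain ⟨C, hC⟩ := hu.exists_abs_le one_pos
  refine ⟨_, tendsto_limUnder_of_hasDerivAt_of_integrableOn_Ioi (a := 1)
    (fun t ht => hu.hasDerivAt_wave (one_pos.trans ht)) ?_⟩
  have hint :=
    (integrableOn_Ioi_rpow_of_lt (by norm_num : (-2 : ℝ) < -1) one_pos).const_mul (|κ| * C)
  refine Integrable.mono' hint ?_ ?_
  · refine ContinuousOn.aestronglyMeasurable (fun t ht => ?_) measurableSet_Ioi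
    have ht0 : (0 : ℝ) < t := one_pos.trans ht
    have h1 : ContinuousAt u t := (hu t ht0).1.continuousAt
    have h2 : t ^ 2 ≠ 0 := by positivity
    exact ContinuousAt.continuousWithinAt (by fun_prop (disch := assumption))
  · refine (ae_restrict_iff' measurableSet_Ioi).2 (Eventually.of_forall fun t ht => ?_)
    have ht0 : (0 : ℝ) < t := one_pos.trans ht
    have h : ‖Complex.exp (-(t * Complex.I))‖ = 1 := by
      rw [← neg_mul, ← Complex.ofReal_neg]; exact Complex.norm_exp_ofReal_mul_I _
    rw [norm_mul, h, mul_one, Complex.norm_real, Real.norm_eq_abs, abs_div, abs_mul,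
      abs_of_pos (by positivity : 0 < t ^ 2), Real.rpow_neg ht0.le, Real.rpow_two, ← div_eq_mul_inv]
    have := hC t (le_of_lt ht)
    gcongr

theorem tendsto_wronskian {w z : ℂ} (hu : Tendsto (wave u u') atTop (𝓝 w))
    (hv : Tendsto (wave v v') atTop (𝓝 z)) :
    Tendsto (fun t => u' t * v t - u t * v' t) atTop (𝓝 (-((starRingEnd ℂ) z * w).im)) := by
  simp only [wronskian_eq_wave]
  exact ((Complex.continuous_im.tendsto _).comp
    (((Complex.continuous_conj.tendsto _).comp hv).mul hu)).neg

end IsNormalSol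

/-- The normal form `√t J_ν(t)` of the Bessel function. -/
noncomputable def normalJ (ν t : ℝ) : ℝ := √t * besselJ ν t

/-- The derivative of `normalJ`. -/
noncomputable def normalJ' (ν t : ℝ) : ℝ :=
  √t * ((ν + 1 / 2) / t * besselJ ν t - besselJ (ν + 1) t)

theorem isNormalSol_normalJ (ν : ℝ) : IsNormalSol (ν ^ 2 - 1 / 4) (normalJ ν) (normalJ' ν) := by
  intro t ht
  have hs : HasDerivAt (fun t : ℝ => √t) (√t / (2 * t)) t := by
    refine (Real.hasDerivAt_sqrt ht.ne').congr_deriv ?_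
    have := Real.sq_sqrt ht.le
    have h0 : √t ≠ 0 := by positivity
    field_simp
    exact this.symm
  have hJ := hasDerivAt_besselJ ht ν
  have hJ1 := hasDerivAt_besselJ' ht (ν + 1)
  rw [add_sub_cancel_right] at hJ1
  have hi : HasDerivAt (fun t : ℝ => (ν + 1 / 2) / t) (-(ν + 1 / 2) / t ^ 2) t :=
    hasDerivAt_const_div _ ht.ne'
  constructor
  · refine (hs.mul hJ).congr_deriv ?_
    rw [normalJ']
    field_simp
    ring
  · refine (hs.mul ((hi.mul hJ).sub hJ1)).congr_deriv ?_
    simp only [normalJ, Pi.mul_apply, Pi.sub_apply]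
    field_simp
    ring

theorem wave_normalJ_add_one {t : ℝ} (ht : 0 < t) (ν : ℝ) :
    wave (normalJ (ν + 1)) (normalJ' (ν + 1)) t = -Complex.I * wave (normalJ ν) (normalJ' ν) t +
      (((ν + 1 / 2) / t : ℝ) * (-normalJ (ν + 1) t + normalJ ν t * Complex.I)) *
        Complex.exp (-(t * Complex.I)) := by
  have h1 : normalJ' ν t = (ν + 1 / 2) / t * normalJ ν t - normalJ (ν + 1) t := by
    simp only [normalJ, normalJ']; ring
  have h2 : normalJ' (ν + 1) t = normalJ ν t - (ν + 1 / 2) / t * normalJ (ν + 1) t := by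
    have := besselJ_add_sub ht (ν + 1)
    rw [add_sub_cancel_right] at this
    simp only [normalJ, normalJ']
    linear_combination (-√t) * this
  simp only [wave, h1, h2]
  push_cast
  linear_combination (normalJ ν t * Complex.exp (-(t * Complex.I))) * Complex.I_sq

theorem tendsto_wave_normalJ_add_one_iff {ν : ℝ} {w : ℂ} :
    Tendsto (wave (normalJ (ν + 1)) (normalJ' (ν + 1))) atTop (𝓝 (-Complex.I * w)) ↔
      Tendsto (wave (normalJ ν) (normalJ' ν)) atTop (𝓝 w) := by
  have h0 : Tendsto (fun t : ℝ =>
      (((ν + 1 / 2) / t : ℝ) * (-normalJ (ν + 1) t + normalJ ν t * Complex.I)) *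
        Complex.exp (-(t * Complex.I))) atTop (𝓝 0) := by
    obtain ⟨C, hC⟩ := (isNormalSol_normalJ ν).exists_abs_le one_pos
    obtain ⟨D, hD⟩ := (isNormalSol_normalJ (ν + 1)).exists_abs_le one_pos
    have h1 : Tendsto (fun t : ℝ => |(ν + 1 / 2) / t| * (D + C)) atTop (𝓝 (|0| * (D + C))) :=
      (tendsto_const_nhds.div_atTop tendsto_id).abs.mul_const _
    rw [abs_zero, zero_mul] at h1
    refine squeeze_zero_norm' ((eventually_ge_atTop 1).mono fun t ht => ?_) h1
    have h : ‖Complex.exp (-(t * Complex.I))‖ = 1 := by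
      rw [← neg_mul, ← Complex.ofReal_neg]; exact Complex.norm_exp_ofReal_mul_I _
    rw [norm_mul, norm_mul, h, mul_one, Complex.norm_real, Real.norm_eq_abs]
    gcongr
    refine (norm_add_le _ _).trans (add_le_add ?_ ?_)
    · rw [norm_neg, Complex.norm_real]; exact hD t ht
    · rw [norm_mul, Complex.norm_I, mul_one, Complex.norm_real]; exact hC t ht
  constructor <;> intro h
  · have h2 := (h.sub h0).const_mul Complex.I
    rw [sub_zero, ← mul_assoc, mul_neg, Complex.I_mul_I, neg_neg, one_mul] at h2
    refine h2.congr' ((eventually_gt_atTop 0).mono fun t ht => ?_)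
    rw [wave_normalJ_add_one ht]
    linear_combination (-wave (normalJ ν) (normalJ' ν) t) * Complex.I_mul_I
  · have h2 := (h.const_mul (-Complex.I)).add h0
    rw [add_zero] at h2
    exact h2.congr' ((eventually_gt_atTop 0).mono fun t ht => (wave_normalJ_add_one ht ν).symm)

/-- The amplitude at infinity of `√t J_ν(t)`. -/
noncomputable def besselAmplitude (ν : ℝ) : ℂ :=
  (√(2 / π) : ℝ) * Complex.I * Complex.exp (-((ν * π / 2 + π / 4 : ℝ) * Complex.I))

theorem besselAmplitude_add_one (ν : ℝ) :
    besselAmplitude (ν + 1) = -Complex.I * besselAmplitude ν := by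
  have h : Complex.exp (-(((ν + 1) * π / 2 + π / 4 : ℝ) * Complex.I)) =
      Complex.exp (-((ν * π / 2 + π / 4 : ℝ) * Complex.I)) * -Complex.I := by
    rw [show -(((ν + 1) * π / 2 + π / 4 : ℝ) * Complex.I) =
      -((ν * π / 2 + π / 4 : ℝ) * Complex.I) + -(π / 2 * Complex.I) by push_cast; ring,
      Complex.exp_add, Complex.exp_neg (π / 2 * Complex.I), Complex.exp_pi_div_two_mul_I,
      Complex.inv_I]
  rw [besselAmplitude, besselAmplitude, h]
  ring

section Laplace

variable {μ : ℝ}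

theorem exists_abs_besselJ_le_rpow {ν : ℝ} (hν : 0 ≤ ν) :
    ∃ C, 0 ≤ C ∧ ∀ t, 0 < t → |besselJ ν t| ≤ C * t ^ ν := by
  obtain ⟨C, hC0, hC⟩ := exists_abs_besselJ_le |ν| 1
  obtain ⟨D, hD⟩ := (isNormalSol_normalJ ν).exists_abs_le one_pos
  refine ⟨max C D, hC0.trans (le_max_left _ _), fun t ht => ?_⟩
  rcases le_total t 1 with h | h
  · refine (hC ν t le_rfl ht h).trans ?_
    gcongr
    exact le_max_left _ _
  · have h1 := hD t h
    rw [normalJ, abs_mul, abs_of_nonneg (Real.sqrt_nonneg t)] at h1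
    have h2 : 1 ≤ √t := Real.one_le_sqrt.2 h
    have h3 : 1 ≤ t ^ ν := Real.one_le_rpow h hν
    calc |besselJ ν t| ≤ √t * |besselJ ν t| := le_mul_of_one_le_left (abs_nonneg _) h2
      _ ≤ max C D := h1.trans (le_max_right _ _)
      _ ≤ max C D * t ^ ν := le_mul_of_one_le_right (hC0.trans (le_max_left _ _)) h3

theorem exists_abs_normalJ_le {ν : ℝ} (hν : 0 ≤ ν) :
    ∃ C, ∀ t, 0 < t → |normalJ ν t| ≤ C := by
  obtain ⟨C, hC0, hC⟩ := exists_abs_besselJ_le |ν| 1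
  obtain ⟨D, hD⟩ := (isNormalSol_normalJ ν).exists_abs_le one_pos
  refine ⟨max C D, fun t ht => ?_⟩
  rcases le_total t 1 with h | h
  · refine le_trans ?_ (le_max_left _ _)
    rw [normalJ, abs_mul, abs_of_nonneg (Real.sqrt_nonneg t)]
    have h2 : √t ≤ 1 := Real.sqrt_le_one.2 h
    have h3 : t ^ ν ≤ 1 := Real.rpow_le_one ht.le h hν
    calc √t * |besselJ ν t| ≤ 1 * (C * 1) := by
          gcongr
          exact (hC ν t le_rfl ht h).trans (by gcongr)
      _ = C := by ring
  · exact (hD t h).trans (le_max_right _ _)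

theorem hasDerivAt_rpow_mul_besselJ {t : ℝ} (ht : 0 < t) :
    HasDerivAt (fun t => t ^ μ * besselJ μ t) (t ^ μ * besselJ (μ - 1) t) t := by
  refine ((Real.hasDerivAt_rpow_const (Or.inl ht.ne')).mul
    (hasDerivAt_besselJ' ht μ)).congr_deriv ?_
  rw [Real.rpow_sub_one ht.ne']
  field_simp
  ring

theorem hasDerivAt_rpow_mul_besselJ_sub_one {t : ℝ} (ht : 0 < t) :
    HasDerivAt (fun t => t ^ μ * besselJ (μ - 1) t)
      ((2 * μ - 1) / t * (t ^ μ * besselJ (μ - 1) t) - t ^ μ * besselJ μ t) t := by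
  refine ((Real.hasDerivAt_rpow_const (Or.inl ht.ne')).mul
    (hasDerivAt_besselJ ht (μ - 1))).congr_deriv ?_
  rw [Real.rpow_sub_one ht.ne', sub_add_cancel]
  field_simp
  ring

theorem integrableOn_rpow_mul_exp_neg_mul {s b : ℝ} (hs : -1 < s) (hb : 0 < b) :
    IntegrableOn (fun t : ℝ => t ^ s * Real.exp (-(b * t))) (Ioi 0) := by
  simpa using integrableOn_rpow_mul_exp_neg_mul_rpow hs one_pos hb

theorem norm_exp_neg_mul (p : ℂ) (t : ℝ) : ‖Complex.exp (-(p * t))‖ = Real.exp (-(p.re * t)) := by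
  simp [Complex.norm_exp]

theorem aestronglyMeasurable_exp_mul {f : ℝ → ℝ} (hf : ContinuousOn f (Ioi 0)) (p : ℂ) :
    AEStronglyMeasurable (fun t : ℝ => Complex.exp (-(p * t)) * f t) (volume.restrict (Ioi 0)) := by
  refine ContinuousOn.aestronglyMeasurable ?_ measurableSet_Ioi
  have : ContinuousOn (fun t => (f t : ℂ)) (Ioi 0) := Complex.continuous_ofReal.comp_continuousOn hf
  exact ContinuousOn.mul (by fun_prop) this

theorem integrableOn_exp_mul {f : ℝ → ℝ} (hf : ContinuousOn f (Ioi 0)) {C s : ℝ} (hs : -1 < s)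
    (hC : ∀ t, 0 < t → |f t| ≤ C * t ^ s) {p : ℂ} (hp : 0 < p.re) :
    IntegrableOn (fun t : ℝ => Complex.exp (-(p * t)) * f t) (Ioi 0) := by
  refine Integrable.mono' ((integrableOn_rpow_mul_exp_neg_mul hs hp).const_mul C)
    (aestronglyMeasurable_exp_mul hf p) ?_
  refine (ae_restrict_iff' measurableSet_Ioi).2 (Eventually.of_forall fun t ht => ?_)
  rw [norm_mul, norm_exp_neg_mul, Complex.norm_real, mul_comm, ← mul_assoc]
  exact mul_le_mul_of_nonneg_right (hC t ht) (Real.exp_pos _).le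

/-- A Laplace transform may be differentiated under the integral sign. -/
theorem hasDerivAt_laplace {f : ℝ → ℝ} (hf : ContinuousOn f (Ioi 0)) {C s : ℝ} (hs : -1 < s)
    (hC : ∀ t, 0 < t → |f t| ≤ C * t ^ s) {p : ℂ} (hp : 0 < p.re) :
    HasDerivAt (fun p : ℂ => ∫ t in Ioi (0 : ℝ), Complex.exp (-(p * t)) * f t)
      (∫ t in Ioi (0 : ℝ), Complex.exp (-(p * t)) * ((-t * f t : ℝ) : ℂ)) p := by
  have hU : {q : ℂ | p.re / 2 < q.re} ∈ 𝓝 p :=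
    (isOpen_lt continuous_const Complex.continuous_re).mem_nhds (by simpa using hp)
  have hf' : ContinuousOn (fun t => -t * f t) (Ioi 0) := by fun_prop
  refine (hasDerivAt_integral_of_dominated_loc_of_deriv_le
    (F' := fun (q : ℂ) (t : ℝ) => Complex.exp (-(q * t)) * ((-t * f t : ℝ) : ℂ))
    (bound := fun t => C * (t ^ (s + 1) * Real.exp (-(p.re / 2 * t)))) hU
    (Eventually.of_forall fun q => aestronglyMeasurable_exp_mul hf q)
    (integrableOn_exp_mul hf hs hC hp) (aestronglyMeasurable_exp_mul hf' p) ?_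
    ((integrableOn_rpow_mul_exp_neg_mul (by linarith) (by linarith)).const_mul C) ?_).2
  · refine (ae_restrict_iff' measurableSet_Ioi).2 (Eventually.of_forall fun t ht q hq => ?_)
    have ht' : 0 < t := ht
    rw [norm_mul, norm_exp_neg_mul, Complex.norm_real, Real.norm_eq_abs, abs_mul, abs_neg,
      abs_of_pos ht', Real.rpow_add_one ht'.ne']
    have h1 : Real.exp (-(q.re * t)) ≤ Real.exp (-(p.re / 2 * t)) := by
      have : p.re / 2 < q.re := hq
      gcongr
    calc Real.exp (-(q.re * t)) * (t * |f t|)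
        ≤ Real.exp (-(p.re / 2 * t)) * (t * (C * t ^ s)) := by
          gcongr
          exact hC t ht'
      _ = _ := by ring
  · refine Eventually.of_forall fun t q _ => ?_
    have h1 : HasDerivAt (fun q : ℂ => -(q * t)) (-t) q := by
      simpa using ((hasDerivAt_id q).mul_const (t : ℂ)).fun_neg
    refine (h1.cexp.mul_const _).congr_deriv ?_
    push_cast
    ring

/-- The Laplace transform of `t ^ μ * J_μ(t)`. -/
noncomputable def besselLaplace (μ : ℝ) (p : ℂ) : ℂ :=
  ∫ t in Ioi (0 : ℝ), Complex.exp (-(p * t)) * ((t ^ μ * besselJ μ t : ℝ) : ℂ)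

theorem continuousOn_rpow_mul_besselJ : ContinuousOn (fun t => t ^ μ * besselJ μ t) (Ioi 0) :=
  fun _ ht => (hasDerivAt_rpow_mul_besselJ ht).continuousAt.continuousWithinAt

theorem exists_abs_rpow_mul_besselJ_le (hμ : 0 ≤ μ) :
    ∃ C, 0 ≤ C ∧ ∀ t, 0 < t → |t ^ μ * besselJ μ t| ≤ C * t ^ (2 * μ) := by
  obtain ⟨C, hC0, hC⟩ := exists_abs_besselJ_le_rpow hμ
  refine ⟨C, hC0, fun t ht => ?_⟩
  rw [abs_mul, abs_of_nonneg (by positivity), two_mul, Real.rpow_add ht]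
  calc t ^ μ * |besselJ μ t| ≤ t ^ μ * (C * t ^ μ) := by gcongr; exact hC t ht
    _ = _ := by ring

theorem tendsto_exp_mul_zero {f : ℝ → ℝ} {C s : ℝ} (hC : ∀ t, 0 < t → |f t| ≤ C * t ^ s)
    {p : ℂ} (hp : 0 < p.re) :
    Tendsto (fun t : ℝ => Complex.exp (-(p * t)) * f t) atTop (𝓝 0) := by
  have h := (tendsto_rpow_mul_exp_neg_mul_atTop_nhds_zero s p.re hp).const_mul C
  rw [mul_zero] at h
  refine squeeze_zero_norm' ((eventually_gt_atTop 0).mono fun t ht => ?_) h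
  rw [norm_mul, norm_exp_neg_mul, Complex.norm_real, mul_comm, ← mul_assoc, neg_mul]
  exact mul_le_mul_of_nonneg_right (hC t ht) (Real.exp_pos _).le

theorem tendsto_exp_mul_zero_nhdsGT {f : ℝ → ℝ} {C s : ℝ} (hs : 0 < s)
    (hC : ∀ t, 0 < t → |f t| ≤ C * t ^ s) (p : ℂ) :
    Tendsto (fun t : ℝ => Complex.exp (-(p * t)) * f t) (𝓝[>] 0) (𝓝 0) := by
  have h : Tendsto (fun t : ℝ => Real.exp (-(p.re * t)) * (C * t ^ s)) (𝓝[>] 0) (𝓝 0) := by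
    have : Continuous fun t : ℝ => Real.exp (-(p.re * t)) * (C * t ^ s) := by
      have := Real.continuous_rpow_const hs.le
      fun_prop
    have h1 := (this.tendsto 0).mono_left (nhdsWithin_le_nhds (s := Ioi 0))
    simpa [Real.zero_rpow hs.ne'] using h1
  refine squeeze_zero_norm' (eventually_nhdsWithin_of_forall fun t ht => ?_) h
  rw [norm_mul, norm_exp_neg_mul, Complex.norm_real]
  exact mul_le_mul_of_nonneg_left (hC t ht) (Real.exp_pos _).le

/-- The first-order differential equation satisfied by `besselLaplace`, in integrated form. -/
theorem besselLaplace_ode (hμ : 1 ≤ μ) {p : ℂ} (hp : 0 < p.re) :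
    (p ^ 2 + 1) * (∫ t in Ioi (0 : ℝ),
        Complex.exp (-(p * t)) * ((-t * (t ^ μ * besselJ μ t) : ℝ) : ℂ)) +
      (2 * μ + 1) * p * besselLaplace μ p = 0 := by
  obtain ⟨C, hC0, hC⟩ := exists_abs_rpow_mul_besselJ_le (zero_le_one.trans hμ)
  obtain ⟨D, hD0, hD⟩ := exists_abs_besselJ_le_rpow (sub_nonneg.2 hμ)
  set f : ℝ → ℝ := fun t => t ^ μ * besselJ μ t with hf
  set g : ℝ → ℝ := fun t => -t * f t with hg
  set h : ℝ → ℝ := fun t => t * (t ^ μ * besselJ (μ - 1) t) with hh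
  have hCg : ∀ t, 0 < t → |g t| ≤ C * t ^ (2 * μ + 1) := fun t ht => by
    rw [hg, abs_mul, abs_neg, abs_of_pos ht, Real.rpow_add_one ht.ne']
    calc t * |f t| ≤ t * (C * t ^ (2 * μ)) := by gcongr; exact hC t ht
      _ = _ := by ring
  have hDh : ∀ t, 0 < t → |h t| ≤ D * t ^ (2 * μ) := fun t ht => by
    rw [hh, abs_mul, abs_of_pos ht, abs_mul, abs_of_nonneg (by positivity : 0 ≤ t ^ μ)]
    calc t * (t ^ μ * |besselJ (μ - 1) t|) ≤ t * (t ^ μ * (D * t ^ (μ - 1))) := by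
          gcongr; exact hD t ht
      _ = _ := by rw [two_mul, Real.rpow_add ht, Real.rpow_sub_one ht.ne']; field_simp
  have hfc : ContinuousOn f (Ioi 0) := continuousOn_rpow_mul_besselJ
  have hgc : ContinuousOn g (Ioi 0) := by fun_prop
  have If := integrableOn_exp_mul hfc (by linarith) hC hp
  have Ig := integrableOn_exp_mul hgc (by linarith) hCg hp
  set Ψ : ℝ → ℂ := fun t => Complex.exp (-(p * t)) * h t - p * (Complex.exp (-(p * t)) * g t) -
    2 * μ * (Complex.exp (-(p * t)) * f t) with hΨ
  have hd : ∀ t ∈ Ioi (0 : ℝ), HasDerivAt Ψ ((p ^ 2 + 1) * (Complex.exp (-(p * t)) * g t) +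
      (2 * μ + 1) * p * (Complex.exp (-(p * t)) * f t)) t := by
    intro t ht
    have ht' : (0 : ℝ) < t := ht
    have ht0 : (t : ℂ) ≠ 0 := by exact_mod_cast ht'.ne'
    have he : HasDerivAt (fun t : ℝ => Complex.exp (-(p * t))) (Complex.exp (-(p * t)) * -p) t := by
      have := ((hasDerivAt_id t).ofReal_comp.const_mul p).fun_neg.cexp
      simpa using this
    have h1 := hasDerivAt_rpow_mul_besselJ (μ := μ) ht'
    have h2 := (hasDerivAt_id t).mul (hasDerivAt_rpow_mul_besselJ_sub_one (μ := μ) ht')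
    have h3 := (hasDerivAt_id t).neg.mul h1
    refine (((he.mul h2.ofReal_comp).sub ((he.mul h3.ofReal_comp).const_mul p)).sub
      ((he.mul h1.ofReal_comp).const_mul (2 * μ : ℂ))).congr_deriv ?_
    simp only [hg, hf, id, Pi.mul_apply, Pi.neg_apply]
    push_cast
    field_simp
    ring
  have hint : IntegrableOn (fun t : ℝ => (p ^ 2 + 1) * (Complex.exp (-(p * t)) * g t) +
      (2 * μ + 1) * p * (Complex.exp (-(p * t)) * f t)) (Ioi 0) :=
    (Ig.const_mul _).add (If.const_mul _)
  have hΨ0 : Ψ 0 = 0 := by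
    simp [hΨ, hf, hg, hh, Real.zero_rpow (by linarith : μ ≠ 0)]
  have h0 : ContinuousWithinAt Ψ (Ici 0) 0 := by
    rw [← continuousWithinAt_Ioi_iff_Ici, ContinuousWithinAt, hΨ0]
    have hμ0 : 0 < 2 * μ := by linarith
    have hμ1 : 0 < 2 * μ + 1 := by linarith
    have key := ((tendsto_exp_mul_zero_nhdsGT hμ0 hDh p).sub
      ((tendsto_exp_mul_zero_nhdsGT hμ1 hCg p).const_mul p)).sub
      ((tendsto_exp_mul_zero_nhdsGT hμ0 hC p).const_mul (2 * μ : ℂ))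
    simp only [mul_zero, sub_zero] at key
    exact key
  have h1 : Tendsto Ψ atTop (𝓝 0) := by
    have key := ((tendsto_exp_mul_zero hDh hp).sub
      ((tendsto_exp_mul_zero hCg hp).const_mul p)).sub
      ((tendsto_exp_mul_zero hC hp).const_mul (2 * μ : ℂ))
    simp only [mul_zero, sub_zero] at key
    exact key
  have hlim := integral_Ioi_of_hasDerivAt_of_tendsto h0 hd hint h1
  rw [integral_add (Ig.const_mul _) (If.const_mul _), integral_const_mul, integral_const_mul,
    hΨ0, sub_zero] at hlim
  exact hlim

theorem one_add_sq_mem_slitPlane {p : ℂ} (hp : 0 < p.re) : 1 + p ^ 2 ∈ Complex.slitPlane := by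
  rw [Complex.mem_slitPlane_iff]
  by_cases h : p.im = 0
  · left
    simp only [sq, Complex.add_re, Complex.one_re, Complex.mul_re, h]
    nlinarith
  · right
    simp only [sq, Complex.add_im, Complex.one_im, Complex.mul_im, zero_add]
    intro h'
    have h2 : p.re * p.im = 0 := by linarith
    exact h ((mul_eq_zero.1 h2).resolve_left hp.ne')

theorem exists_besselLaplace_eq (hμ : 1 ≤ μ) : ∃ c : ℂ, ∀ p : ℂ, 0 < p.re →
    besselLaplace μ p * (1 + p ^ 2) ^ ((μ + 1 / 2 : ℝ) : ℂ) = c := by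
  obtain ⟨C, hC0, hC⟩ := exists_abs_rpow_mul_besselJ_le (zero_le_one.trans hμ)
  have hd : ∀ p : ℂ, 0 < p.re → HasDerivAt
      (fun p => besselLaplace μ p * (1 + p ^ 2) ^ ((μ + 1 / 2 : ℝ) : ℂ)) 0 p := by
    intro p hp
    have h1 := hasDerivAt_laplace continuousOn_rpow_mul_besselJ (by linarith) hC hp
    have hs := one_add_sq_mem_slitPlane hp
    have h2 : HasDerivAt (fun p : ℂ => 1 + p ^ 2) (2 * p) p := by
      simpa using (hasDerivAt_pow 2 p).const_add 1
    have h3 := h2.cpow_const (c := ((μ + 1 / 2 : ℝ) : ℂ)) hs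
    refine (h1.mul h3).congr_deriv ?_
    have h4 := besselLaplace_ode hμ hp
    rw [besselLaplace] at h4
    rw [Complex.cpow_sub _ _ (Complex.slitPlane_ne_zero hs), Complex.cpow_one]
    have hs0 := Complex.slitPlane_ne_zero hs
    generalize (1 + p ^ 2) ^ ((μ + 1 / 2 : ℝ) : ℂ) = E at *
    generalize (∫ t in Ioi (0 : ℝ),
      Complex.exp (-(p * t)) * ((-t * (t ^ μ * besselJ μ t) : ℝ) : ℂ)) = A at *
    generalize (∫ t in Ioi (0 : ℝ),
      Complex.exp (-(p * t)) * ((t ^ μ * besselJ μ t : ℝ) : ℂ)) = B at *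
    push_cast
    field_simp
    linear_combination E * h4
  have hU : IsOpen {p : ℂ | 0 < p.re} := isOpen_lt continuous_const Complex.continuous_re
  have hUc : IsPreconnected {p : ℂ | 0 < p.re} := (convex_halfSpace_re_gt 0).isPreconnected
  obtain ⟨c, hc⟩ := hU.exists_is_const_of_deriv_eq_zero hUc
    (fun p hp => (hd p hp).differentiableAt.differentiableWithinAt) (fun p hp => (hd p hp).deriv)
  exact ⟨c, hc⟩

theorem besselS_zero (μ : ℝ) : besselS μ 0 = 1 / Real.Gamma (μ + 1) := by
  rw [besselS, tsum_eq_single 0]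
  · simp
  · intro k hk
    simp [hk]

theorem tendsto_besselLaplace_atTop (hμ : 1 ≤ μ) :
    Tendsto (fun R : ℝ => ((R ^ (2 * μ + 1) : ℝ) : ℂ) * besselLaplace μ R) atTop
      (𝓝 ((2 ^ μ * Real.Gamma (μ + 1 / 2) / √π : ℝ) : ℂ)) := by
  have hμ0 : 0 ≤ μ := by linarith
  obtain ⟨C, hC0, hC⟩ := exists_abs_rpow_mul_besselJ_le hμ0
  have hlim : Tendsto (fun R : ℝ => ∫ s in Ioi (0 : ℝ),
      Real.exp (-s) * (R ^ (2 * μ) * ((R⁻¹ * s) ^ μ * besselJ μ (R⁻¹ * s)))) atTop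
      (𝓝 (∫ s in Ioi (0 : ℝ),
        Real.exp (-s) * (s ^ (2 * μ) * (2 ^ (-μ) * (1 / Real.Gamma (μ + 1)))))) := by
    refine tendsto_integral_filter_of_dominated_convergence
      (fun s => C * (s ^ (2 * μ) * Real.exp (-(1 * s)))) ?_ ?_
      ((integrableOn_rpow_mul_exp_neg_mul (by linarith) one_pos).const_mul C) ?_
    · filter_upwards [eventually_gt_atTop 0] with R hR
      refine ContinuousOn.aestronglyMeasurable ?_ measurableSet_Ioi
      have h1 : ContinuousOn (fun s => (R⁻¹ * s) ^ μ * besselJ μ (R⁻¹ * s)) (Ioi 0) :=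
        (continuousOn_rpow_mul_besselJ (μ := μ)).comp (by fun_prop)
          (fun s hs => mul_pos (inv_pos.2 hR) hs)
      fun_prop
    · filter_upwards [eventually_gt_atTop 0] with R hR
      refine (ae_restrict_iff' measurableSet_Ioi).2 (Eventually.of_forall fun s hs => ?_)
      have hs' : (0 : ℝ) < s := hs
      have h1 := hC (R⁻¹ * s) (by positivity)
      rw [Real.norm_eq_abs, abs_mul, abs_mul, abs_of_pos (Real.exp_pos _),
        abs_of_pos (by positivity : 0 < R ^ (2 * μ)), one_mul]
      rw [Real.mul_rpow (by positivity) hs'.le (z := 2 * μ), Real.inv_rpow hR.le] at h1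
      calc Real.exp (-s) * (R ^ (2 * μ) * |(R⁻¹ * s) ^ μ * besselJ μ (R⁻¹ * s)|)
          ≤ Real.exp (-s) * (R ^ (2 * μ) * (C * ((R ^ (2 * μ))⁻¹ * s ^ (2 * μ)))) := by gcongr
        _ = _ := by field_simp
    · refine (ae_restrict_iff' measurableSet_Ioi).2 (Eventually.of_forall fun s hs => ?_)
      have hs' : (0 : ℝ) < s := hs
      have h0 : Tendsto (fun R : ℝ => (R⁻¹ * s) ^ 2 / 4) atTop (𝓝 0) := by
        have h := ((tendsto_inv_atTop_zero.mul_const s).pow 2).div_const (4 : ℝ)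
        simpa using h
      have h1 := ((hasDerivAt_besselS μ 0).continuousAt.tendsto.comp h0)
      rw [besselS_zero] at h1
      refine (((h1.const_mul (2 ^ (-μ))).const_mul (s ^ (2 * μ))).const_mul
        (Real.exp (-s))).congr' ?_
      filter_upwards [eventually_gt_atTop 0] with R hR
      rw [besselJ_eq, Function.comp_apply, Real.mul_rpow (by positivity) hs'.le,
        Real.div_rpow (by positivity) (by positivity), Real.mul_rpow (by positivity) hs'.le,
        Real.inv_rpow hR.le, Real.rpow_neg (by positivity), two_mul, Real.rpow_add hR,
        Real.rpow_add hs']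
      field_simp
  have hval : ∫ s in Ioi (0 : ℝ),
      Real.exp (-s) * (s ^ (2 * μ) * (2 ^ (-μ) * (1 / Real.Gamma (μ + 1)))) =
      2 ^ μ * Real.Gamma (μ + 1 / 2) / √π := by
    have h1 := Real.Gamma_eq_integral (s := 2 * μ + 1) (by linarith)
    have h2 := Real.Gamma_mul_Gamma_add_half (μ + 1 / 2)
    simp_rw [← mul_assoc]
    rw [integral_mul_const, integral_mul_const, add_sub_cancel_right] at *
    rw [← h1]
    have hg : Real.Gamma (μ + 1) ≠ 0 := (Real.Gamma_pos_of_pos (by linarith)).ne'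
    rw [show μ + 1 / 2 + 1 / 2 = μ + 1 by ring, show 2 * (μ + 1 / 2) = 2 * μ + 1 by ring,
      show 1 - (2 * μ + 1) = -μ + -μ by ring, Real.rpow_add two_pos] at h2
    have h3 : (2 : ℝ) ^ (-μ) * 2 ^ μ = 1 := by rw [← Real.rpow_add two_pos]; simp
    have h4 : √π ≠ 0 := by positivity
    generalize Real.Gamma (μ + 1 / 2) = G at *
    field_simp
    linear_combination (-2 ^ μ : ℝ) * h2 - Gamma (2 * μ + 1) * 2 ^ (-μ) * √π * h3
  rw [hval] at hlim
  refine ((Complex.continuous_ofReal.tendsto _).comp hlim).congr' ?_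
  filter_upwards [eventually_gt_atTop 0] with R hR
  have h1 := integral_comp_mul_left_Ioi
    (fun t => Real.exp (-(R * t)) * (t ^ μ * besselJ μ t)) 0 (inv_pos.2 hR)
  have h2 : besselLaplace μ R =
      ((∫ t in Ioi (0 : ℝ), Real.exp (-(R * t)) * (t ^ μ * besselJ μ t) : ℝ) : ℂ) := by
    rw [← integral_complex_ofReal, besselLaplace]
    push_cast
    rfl
  rw [h2, Function.comp_apply, ← Complex.ofReal_mul]
  congr 1
  rw [inv_inv, mul_zero, smul_eq_mul] at h1
  rw [Real.rpow_add_one hR.ne', mul_assoc, ← h1, ← integral_const_mul]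
  refine integral_congr_ae (Eventually.of_forall fun s => ?_)
  have h3 : R * (R⁻¹ * s) = s := by field_simp
  simp only [h3]
  ring

theorem besselLaplace_mul_cpow (hμ : 1 ≤ μ) {p : ℂ} (hp : 0 < p.re) :
    besselLaplace μ p * (1 + p ^ 2) ^ ((μ + 1 / 2 : ℝ) : ℂ) =
      ((2 ^ μ * Real.Gamma (μ + 1 / 2) / √π : ℝ) : ℂ) := by
  obtain ⟨c, hc⟩ := exists_besselLaplace_eq hμ
  rw [hc p hp]
  have h1 : Tendsto (fun R : ℝ => (((1 + (R⁻¹) ^ 2) ^ (μ + 1 / 2) : ℝ) : ℂ)) atTop (𝓝 1) := by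
    have h : Tendsto (fun R : ℝ => (1 + (R⁻¹) ^ 2) ^ (μ + 1 / 2)) atTop
        (𝓝 ((1 + 0 ^ 2) ^ (μ + 1 / 2))) :=
      ((tendsto_inv_atTop_zero.pow 2).const_add (1 : ℝ)).rpow_const (Or.inl (by norm_num))
    have h' := (Complex.continuous_ofReal.tendsto _).comp h
    simpa [Function.comp_def] using h'
  have h2 := (tendsto_besselLaplace_atTop hμ).mul h1
  rw [mul_one] at h2
  refine tendsto_nhds_unique (tendsto_const_nhds.congr' ?_) h2
  filter_upwards [eventually_gt_atTop 0] with R hR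
  rw [← hc R (by simpa using hR)]
  have h3 : (1 + (R : ℂ) ^ 2) ^ ((μ + 1 / 2 : ℝ) : ℂ) = (((1 + R ^ 2) ^ (μ + 1 / 2) : ℝ) : ℂ) := by
    rw [Complex.ofReal_cpow (by positivity)]
    push_cast
    rfl
  have h4 : (1 + R ^ 2) ^ (μ + 1 / 2) = R ^ (2 * μ + 1) * (1 + (R⁻¹) ^ 2) ^ (μ + 1 / 2) := by
    rw [show 2 * μ + 1 = 2 * (μ + 1 / 2) by ring, Real.rpow_mul hR.le,
      ← Real.mul_rpow (by positivity) (by positivity)]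
    congr 1
    rw [Real.rpow_two]
    field_simp
    ring
  rw [h3, h4]
  push_cast
  ring

/-- The Riemann-Lebesgue lemma on a half-line. -/
theorem tendsto_integral_mul_exp_zero {k : ℝ → ℂ} :
    Tendsto (fun R : ℝ => ∫ s in Ioi (0 : ℝ), k s * Complex.exp (-(2 * (R * s : ℝ) * Complex.I)))
      atTop (𝓝 0) := by
  have h := (Real.tendsto_integral_exp_smul_cocompact ((Ioi (0 : ℝ)).indicator k)).comp
    ((tendsto_id.atTop_div_const Real.pi_pos).mono_right atTop_le_cocompact)
  refine h.congr fun R => ?_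
  rw [Function.comp_apply, ← integral_indicator measurableSet_Ioi]
  refine integral_congr_ae (Eventually.of_forall fun s => ?_)
  by_cases hs : s ∈ Ioi (0 : ℝ)
  · simp only [indicator_of_mem hs, Circle.smul_def, Real.fourierChar_apply, smul_eq_mul]
    rw [mul_comm]
    congr 2
    have : (π : ℂ) ≠ 0 := by exact_mod_cast Real.pi_ne_zero
    simp only [id]
    push_cast
    field_simp
  · simp [indicator_of_notMem hs]

theorem wave_sub_conj (u u' : ℝ → ℝ) (t : ℝ) :
    2 * Complex.I * (u t * Complex.exp (-(t * Complex.I))) = wave u u' t -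
      (starRingEnd ℂ) (wave u u' t) * Complex.exp (-(2 * t * Complex.I)) := by
  have h : (starRingEnd ℂ) (Complex.exp (-(t * Complex.I))) * Complex.exp (-(2 * t * Complex.I)) =
      Complex.exp (-(t * Complex.I)) := by
    rw [← Complex.exp_conj, ← Complex.exp_add]
    congr 1
    simp
    ring
  simp only [wave, map_mul, map_add, Complex.conj_ofReal, Complex.conj_I]
  linear_combination (u' t + u t * -Complex.I) * h

theorem tendsto_integral_mul_normalJ (hμ : 1 ≤ μ) {w : ℂ}
    (hw : Tendsto (wave (normalJ μ) (normalJ' μ)) atTop (𝓝 w)) :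
    Tendsto (fun R : ℝ => ∫ s in Ioi (0 : ℝ), ((Real.exp (-s) * s ^ (μ - 1 / 2) : ℝ) : ℂ) *
      (normalJ μ (R * s) * Complex.exp (-((R * s : ℝ) * Complex.I)))) atTop
      (𝓝 (Real.Gamma (μ + 1 / 2) * (w / (2 * Complex.I)))) := by
  have hμ0 : 0 ≤ μ := by linarith
  obtain ⟨C, hC⟩ := exists_abs_normalJ_le hμ0
  set k : ℝ → ℝ := fun s => Real.exp (-s) * s ^ (μ - 1 / 2) with hk
  have hk_int : IntegrableOn k (Ioi 0) := by
    have h := Real.GammaIntegral_convergent (s := μ + 1 / 2) (by linarith)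
    rwa [show μ + 1 / 2 - 1 = μ - 1 / 2 by ring] at h
  have hk_val : ∫ s in Ioi (0 : ℝ), k s = Real.Gamma (μ + 1 / 2) := by
    rw [Real.Gamma_eq_integral (by linarith), show μ + 1 / 2 - 1 = μ - 1 / 2 by ring]
  have hk_intc : IntegrableOn (fun s => (k s : ℂ)) (Ioi 0) := hk_int.ofReal
  have hexp : ∀ x : ℝ, ‖Complex.exp (-(x * Complex.I))‖ = 1 := fun x => by
    rw [← neg_mul, ← Complex.ofReal_neg]; exact Complex.norm_exp_ofReal_mul_I _
  have hexp2 : ∀ x : ℝ, ‖Complex.exp (-(2 * x * Complex.I))‖ = 1 := fun x => by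
    have := hexp (2 * x)
    push_cast at this
    exact this
  set φ : ℝ → ℂ := fun t => normalJ μ t * Complex.exp (-(t * Complex.I)) -
    (w - (starRingEnd ℂ) w * Complex.exp (-(2 * t * Complex.I))) / (2 * Complex.I) with hφ
  have hφc : ContinuousOn φ (Ioi 0) := by
    have h1 : ContinuousOn (normalJ μ) (Ioi 0) := fun t ht =>
      ((isNormalSol_normalJ μ t ht).1).continuousAt.continuousWithinAt
    have h2 : ContinuousOn (fun t => (normalJ μ t : ℂ)) (Ioi 0) :=
      Complex.continuous_ofReal.comp_continuousOn h1
    exact (h2.mul (by fun_prop)).sub (by fun_prop)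
  have hφb : ∀ t, 0 < t → ‖φ t‖ ≤ C + ‖w‖ := fun t ht => by
    refine (norm_sub_le _ _).trans (add_le_add ?_ ?_)
    · rw [norm_mul, hexp, mul_one, Complex.norm_real]
      exact hC t ht
    · rw [norm_div, norm_mul, Complex.norm_I, Complex.norm_two, mul_one,
        div_le_iff₀ two_pos, mul_two]
      refine (norm_sub_le _ _).trans (le_of_eq ?_)
      rw [norm_mul, hexp2, mul_one, RCLike.norm_conj]
  have hφ0 : Tendsto φ atTop (𝓝 0) := by
    have h1 : ∀ t, φ t = ((wave (normalJ μ) (normalJ' μ) t - w) - (starRingEnd ℂ)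
        (wave (normalJ μ) (normalJ' μ) t - w) * Complex.exp (-(2 * t * Complex.I))) /
        (2 * Complex.I) := fun t => by
      have h := wave_sub_conj (normalJ μ) (normalJ' μ) t
      have hI : (2 * Complex.I) ≠ 0 := by simp
      rw [hφ, eq_div_iff hI, sub_mul, div_mul_cancel₀ _ hI, map_sub]
      linear_combination h
    have h2 : Tendsto (fun t => ‖wave (normalJ μ) (normalJ' μ) t - w‖) atTop (𝓝 0) :=
      tendsto_iff_norm_sub_tendsto_zero.1 hw
    refine squeeze_zero_norm (fun t => ?_) h2
    rw [h1, norm_div, norm_mul, Complex.norm_I, Complex.norm_two, mul_one,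
        div_le_iff₀ two_pos, mul_two]
    refine (norm_sub_le _ _).trans (le_of_eq ?_)
    rw [norm_mul, hexp2, mul_one, RCLike.norm_conj]
  have hmeas : ∀ R : ℝ, 0 < R →
      AEStronglyMeasurable (fun s => (k s : ℂ) * φ (R * s)) (volume.restrict (Ioi 0)) :=
    fun R hR => hk_intc.aestronglyMeasurable.mul (ContinuousOn.aestronglyMeasurable
      (hφc.comp (by fun_prop) (fun s hs => mul_pos hR hs)) measurableSet_Ioi)
  have hmain : Tendsto (fun R : ℝ => ∫ s in Ioi (0 : ℝ), (k s : ℂ) * φ (R * s)) atTop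
      (𝓝 (∫ s in Ioi (0 : ℝ), (k s : ℂ) * 0)) := by
    refine tendsto_integral_filter_of_dominated_convergence
      (fun s => ‖k s‖ * (C + ‖w‖)) ?_ ?_ (hk_int.norm.mul_const _) ?_
    · filter_upwards [eventually_gt_atTop 0] with R hR
      exact hmeas R hR
    · filter_upwards [eventually_gt_atTop 0] with R hR
      refine (ae_restrict_iff' measurableSet_Ioi).2 (Eventually.of_forall fun s hs => ?_)
      rw [norm_mul, Complex.norm_real]
      gcongr
      exact hφb _ (mul_pos hR hs)
    · refine (ae_restrict_iff' measurableSet_Ioi).2 (Eventually.of_forall fun s hs => ?_)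
      exact (hφ0.comp (tendsto_id.atTop_mul_const hs)).const_mul _
  have hRL := tendsto_integral_mul_exp_zero (k := fun s => (k s : ℂ))
  have htot := (hmain.add (hRL.const_mul (-(starRingEnd ℂ) w / (2 * Complex.I)))).add_const
    ((Real.Gamma (μ + 1 / 2) : ℂ) * (w / (2 * Complex.I)))
  simp only [mul_zero, integral_zero, add_zero, zero_add] at htot
  refine htot.congr' ?_
  filter_upwards [eventually_gt_atTop 0] with R hR
  have i1 : IntegrableOn (fun s => (k s : ℂ) * φ (R * s)) (Ioi 0) := by
    refine Integrable.mono' (hk_int.norm.mul_const (C + ‖w‖)) (hmeas R hR) ?_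
    · refine (ae_restrict_iff' measurableSet_Ioi).2 (Eventually.of_forall fun s hs => ?_)
      rw [norm_mul, Complex.norm_real]
      gcongr
      exact hφb _ (mul_pos hR hs)
  have i2 : IntegrableOn (fun s => (k s : ℂ) * Complex.exp (-(2 * (R * s : ℝ) * Complex.I)))
      (Ioi 0) := by
    refine Integrable.mono' hk_int.norm (hk_intc.aestronglyMeasurable.mul
      (Continuous.aestronglyMeasurable (by fun_prop))) (Eventually.of_forall fun s => ?_)
    rw [norm_mul, Complex.norm_real, hexp2, mul_one]
  have i3 : IntegrableOn (fun s => (k s : ℂ) * φ (R * s) + -(starRingEnd ℂ) w / (2 * Complex.I) *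
      (k s * Complex.exp (-(2 * (R * s : ℝ) * Complex.I)))) (Ioi 0) := i1.add (i2.const_mul _)
  rw [← hk_val, ← integral_complex_ofReal, ← integral_const_mul, ← integral_mul_const,
    ← integral_add i1 (i2.const_mul _), ← integral_add i3 (hk_intc.mul_const _)]
  refine integral_congr_ae (Eventually.of_forall fun s => ?_)
  simp only [hφ]
  ring

theorem besselLaplace_inv_add_I {R : ℝ} (hR : 0 < R) :
    besselLaplace μ ((R⁻¹ : ℝ) + Complex.I) = ((R ^ (μ + 1 / 2) : ℝ) : ℂ) *
      ∫ s in Ioi (0 : ℝ), ((Real.exp (-s) * s ^ (μ - 1 / 2) : ℝ) : ℂ) *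
        (normalJ μ (R * s) * Complex.exp (-((R * s : ℝ) * Complex.I))) := by
  have h1 := integral_comp_mul_left_Ioi (fun t : ℝ =>
    Complex.exp (-(((R⁻¹ : ℝ) + Complex.I) * t)) * ((t ^ μ * besselJ μ t : ℝ) : ℂ)) 0 hR
  rw [mul_zero, ← besselLaplace] at h1
  have hR0 : (R : ℂ) ≠ 0 := by exact_mod_cast hR.ne'
  have h2 : besselLaplace μ ((R⁻¹ : ℝ) + Complex.I) =
      R * (R⁻¹ • besselLaplace μ ((R⁻¹ : ℝ) + Complex.I)) := by
    rw [Complex.real_smul, Complex.ofReal_inv, mul_inv_cancel_left₀ hR0]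
  rw [h2, ← h1, ← integral_const_mul, ← integral_const_mul]
  refine setIntegral_congr_fun measurableSet_Ioi fun s hs => ?_
  have hs' : (0 : ℝ) < s := hs
  have h3 : Complex.exp (-(((R⁻¹ : ℝ) + Complex.I) * (R * s : ℝ))) =
      (Real.exp (-s) : ℝ) * Complex.exp (-((R * s : ℝ) * Complex.I)) := by
    rw [Complex.ofReal_exp, ← Complex.exp_add]
    congr 1
    push_cast
    field_simp
    ring
  have h4 : R * ((R * s) ^ μ * besselJ μ (R * s)) =
      R ^ (μ + 1 / 2) * (s ^ (μ - 1 / 2) * normalJ μ (R * s)) := by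
    rw [normalJ, Real.sqrt_eq_rpow, Real.mul_rpow hR.le hs'.le, Real.mul_rpow hR.le hs'.le,
      Real.rpow_add hR, Real.rpow_sub hs']
    have h5 : R ^ (1 / 2 : ℝ) * R ^ (1 / 2 : ℝ) = R := by
      rw [← Real.rpow_add hR]; norm_num
    have h6 : s ^ (1 / 2 : ℝ) ≠ 0 := by positivity
    field_simp
    linear_combination (-besselJ μ (R * s)) * h5
  have h4' := congrArg (fun x : ℝ => (x : ℂ)) h4
  simp only [Complex.ofReal_mul] at h3 h4' ⊢
  rw [h3]
  linear_combination Real.exp (-s) * Complex.exp (-(R * s * Complex.I)) * h4'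

theorem ofReal_mul_cpow {r : ℝ} (hr : 0 < r) {x : ℂ} (hx : x ≠ 0) (y : ℂ) :
    (r * x) ^ y = (r : ℂ) ^ y * x ^ y := by
  have hr0 : (r : ℂ) ≠ 0 := by exact_mod_cast hr.ne'
  rw [Complex.cpow_def_of_ne_zero (mul_ne_zero hr0 hx), Complex.cpow_def_of_ne_zero hr0,
    Complex.cpow_def_of_ne_zero hx, Complex.log_ofReal_mul hr hx, ← Complex.exp_add,
    Complex.ofReal_log hr.le, add_mul]

theorem amplitude_eq_of_one_le (hμ : 1 ≤ μ) {w : ℂ}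
    (hw : Tendsto (wave (normalJ μ) (normalJ' μ)) atTop (𝓝 w)) : w = besselAmplitude μ := by
  set a : ℝ := μ + 1 / 2 with ha
  have hpi : √π ≠ 0 := by positivity
  have h1 : Tendsto (fun R : ℝ => ((R⁻¹ : ℝ) : ℂ) + 2 * Complex.I) atTop (𝓝 (2 * Complex.I)) := by
    have h := ((Complex.continuous_ofReal.tendsto _).comp tendsto_inv_atTop_zero).add_const
      (2 * Complex.I)
    rwa [Complex.ofReal_zero, zero_add] at h
  have h2 : 2 * Complex.I ∈ Complex.slitPlane := by simp [Complex.mem_slitPlane_iff]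
  have h3 := (tendsto_integral_mul_normalJ hμ hw).mul
    (h1.cpow (tendsto_const_nhds (x := (a : ℂ))) h2)
  have h4 : Real.Gamma a * (w / (2 * Complex.I)) * (2 * Complex.I) ^ (a : ℂ) =
      ((2 ^ μ * Real.Gamma a / √π : ℝ) : ℂ) := by
    refine tendsto_nhds_unique h3 (tendsto_const_nhds.congr' ?_)
    filter_upwards [eventually_gt_atTop 0] with R hR
    have h5 := besselLaplace_mul_cpow hμ (p := (R⁻¹ : ℝ) + Complex.I) (by simpa using hR)
    have hR0 : (R : ℂ) ≠ 0 := by exact_mod_cast hR.ne'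
    have h6 : 1 + (((R⁻¹ : ℝ) : ℂ) + Complex.I) ^ 2 = (R⁻¹ : ℝ) * ((R⁻¹ : ℝ) + 2 * Complex.I) := by
      linear_combination Complex.I_sq
    have h7 : (((R⁻¹ : ℝ) : ℂ)) ^ (a : ℂ) * ((R ^ a : ℝ) : ℂ) = 1 := by
      rw [← Complex.ofReal_cpow (by positivity), ← Complex.ofReal_mul, Real.inv_rpow hR.le,
        inv_mul_cancel₀ (by positivity), Complex.ofReal_one]
    have h9 : ((R⁻¹ : ℝ) : ℂ) + 2 * Complex.I ≠ 0 := fun h => by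
      simpa using congrArg Complex.im h
    rw [← h5, h6, ofReal_mul_cpow (inv_pos.2 hR) h9, besselLaplace_inv_add_I hR]
    linear_combination ((∫ s in Ioi (0 : ℝ), ((Real.exp (-s) * s ^ (μ - 1 / 2) : ℝ) : ℂ) *
        (normalJ μ (R * s) * Complex.exp (-((R * s : ℝ) * Complex.I)))) *
        (((R⁻¹ : ℝ) : ℂ) + 2 * Complex.I) ^ (a : ℂ)) * h7
  have hG : (Real.Gamma a : ℂ) ≠ 0 := by
    exact_mod_cast (Real.Gamma_pos_of_pos (by linarith)).ne'
  have h8 : (2 * Complex.I) ^ (a : ℂ) = ((2 ^ μ * √2 : ℝ) : ℂ) *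
      Complex.exp ((μ * π / 2 + π / 4 : ℝ) * Complex.I) := by
    have h9 := ofReal_mul_cpow two_pos Complex.I_ne_zero a
    rw [← Complex.ofReal_cpow zero_le_two, ha, Real.rpow_add two_pos, ← Real.sqrt_eq_rpow, ← ha,
      Complex.cpow_def_of_ne_zero Complex.I_ne_zero, Complex.log_I] at h9
    rw [← Complex.ofReal_ofNat, h9, ha]
    congr 2
    push_cast
    ring
  have hE : Complex.exp (-((μ * π / 2 + π / 4 : ℝ) * Complex.I)) *
      Complex.exp ((μ * π / 2 + π / 4 : ℝ) * Complex.I) = 1 := by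
    rw [← Complex.exp_add, neg_add_cancel, Complex.exp_zero]
  have h10 : ((√(2 / π) * √π * √2 : ℝ) : ℂ) = 2 := by
    rw [Real.sqrt_div zero_le_two, div_mul_cancel₀ _ hpi, Real.mul_self_sqrt zero_le_two]
    simp
  have hpi' : (√π : ℂ) ≠ 0 := by exact_mod_cast hpi
  have h2μ : ((2 ^ μ : ℝ) : ℂ) ≠ 0 := by exact_mod_cast (by positivity : (2 : ℝ) ^ μ ≠ 0)
  rw [h8] at h4
  rw [besselAmplitude]
  have h2' : ((√2 : ℝ) : ℂ) ≠ 0 := by exact_mod_cast (by positivity : √(2 : ℝ) ≠ 0)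
  simp only [Complex.ofReal_mul, Complex.ofReal_div] at h4 h10
  generalize Complex.exp (-((μ * π / 2 + π / 4 : ℝ) * Complex.I)) = E at *
  generalize Complex.exp ((μ * π / 2 + π / 4 : ℝ) * Complex.I) = F at *
  generalize ((√(2 / π) : ℝ) : ℂ) = q at *
  field_simp at h4
  have h11 : w * √2 * √π = 2 * Complex.I * E := by
    linear_combination E * h4 - w * √2 * √π * hE
  refine mul_right_cancel₀ (mul_ne_zero h2' hpi') ?_
  linear_combination h11 - Complex.I * E * h10

theorem tendsto_wave_normalJ_of_one_le (hμ : 1 ≤ μ) :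
    Tendsto (wave (normalJ μ) (normalJ' μ)) atTop (𝓝 (besselAmplitude μ)) := by
  obtain ⟨w, hw⟩ := (isNormalSol_normalJ μ).exists_tendsto_wave
  rwa [amplitude_eq_of_one_le hμ hw] at hw

end Laplace

/-- The leading asymptotics of `J_ν` at infinity, for every real order. -/
theorem tendsto_wave_normalJ (ν : ℝ) :
    Tendsto (wave (normalJ ν) (normalJ' ν)) atTop (𝓝 (besselAmplitude ν)) := by
  obtain ⟨n, hn⟩ := exists_nat_ge (1 - ν)
  have key : ∀ (n : ℕ) (ν : ℝ), 1 - ν ≤ n →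
      Tendsto (wave (normalJ ν) (normalJ' ν)) atTop (𝓝 (besselAmplitude ν)) := by
    intro n
    induction n with
    | zero =>
      intro ν h
      rw [Nat.cast_zero] at h
      exact tendsto_wave_normalJ_of_one_le (by linarith)
    | succ n ih =>
      intro ν h
      rw [Nat.cast_succ] at h
      rw [← tendsto_wave_normalJ_add_one_iff, ← besselAmplitude_add_one]
      exact ih _ (by linarith)
  exact key n ν hn

theorem normSq_besselAmplitude (ν : ℝ) : ‖besselAmplitude ν‖ ^ 2 = 2 / π := by
  have h : ‖Complex.exp (-((ν * π / 2 + π / 4 : ℝ) * Complex.I))‖ = 1 := by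
    rw [← neg_mul, ← Complex.ofReal_neg]; exact Complex.norm_exp_ofReal_mul_I _
  rw [besselAmplitude, norm_mul, norm_mul, h, Complex.norm_I, Complex.norm_real, mul_one, mul_one,
    Real.norm_eq_abs, sq_abs, Real.sq_sqrt (by positivity)]

theorem conj_besselAmplitude_mul_re (μ ν : ℝ) :
    ((starRingEnd ℂ) (besselAmplitude ν) * besselAmplitude μ).re =
      2 / π * Real.cos ((μ - ν) * π / 2) := by
  have h1 : (starRingEnd ℂ) (Complex.exp (-((ν * π / 2 + π / 4 : ℝ) * Complex.I))) *
      Complex.exp (-((μ * π / 2 + π / 4 : ℝ) * Complex.I)) =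
      Complex.exp (((-((μ - ν) * π / 2) : ℝ) : ℂ) * Complex.I) := by
    rw [← Complex.exp_conj, ← Complex.exp_add]
    congr 1
    simp only [map_neg, map_mul, Complex.conj_ofReal, Complex.conj_I]
    push_cast
    ring
  have h2 : ((√(2 / π) : ℝ) : ℂ) * (√(2 / π) : ℝ) = (2 / π : ℝ) := by
    rw [← Complex.ofReal_mul, Real.mul_self_sqrt (by positivity)]
  have h3 : (starRingEnd ℂ) (besselAmplitude ν) * besselAmplitude μ = (2 / π : ℝ) *
      Complex.exp (((-((μ - ν) * π / 2) : ℝ) : ℂ) * Complex.I) := by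
    rw [← h1, ← h2]
    simp only [besselAmplitude, map_mul, Complex.conj_ofReal, Complex.conj_I]
    linear_combination (-((√(2 / π) : ℝ) : ℂ) * (√(2 / π) : ℝ) *
      (starRingEnd ℂ) (Complex.exp (-((ν * π / 2 + π / 4 : ℝ) * Complex.I))) *
      Complex.exp (-((μ * π / 2 + π / 4 : ℝ) * Complex.I))) * Complex.I_sq
  rw [h3, Complex.re_ofReal_mul, Complex.exp_ofReal_mul_I_re, Real.cos_neg]

theorem besselAmplitude_neg (ν : ℝ) :
    besselAmplitude (-ν) =
      (Real.cos (ν * π) + Real.sin (ν * π) * Complex.I) * besselAmplitude ν := by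
  rw [Complex.ofReal_cos, Complex.ofReal_sin, ← Complex.exp_mul_I, besselAmplitude, besselAmplitude,
    mul_left_comm, ← Complex.exp_add]
  congr 2
  push_cast
  ring

theorem wave_smul_sub (u u' v v' : ℝ → ℝ) (a b t : ℝ) :
    wave (fun t => a * u t - b * v t) (fun t => a * u' t - b * v' t) t =
      a * wave u u' t - b * wave v v' t := by
  simp only [wave]
  push_cast
  ring

theorem isNormalSol_normalJ_neg (ν : ℝ) :
    IsNormalSol (ν ^ 2 - 1 / 4) (normalJ (-ν)) (normalJ' (-ν)) := by
  have h := isNormalSol_normalJ (-ν)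
  rwa [neg_sq] at h

theorem besselJ_neg_int {x : ℝ} (hx : 0 < x) (n : ℤ) :
    besselJ n x * Real.cos (n * π) - besselJ (-n) x = 0 := by
  have h1 := ((isNormalSol_normalJ n).smul (Real.cos (n * π))).sub
    ((isNormalSol_normalJ_neg n).smul 1)
  have h2 : Tendsto (wave (fun t => Real.cos (n * π) * normalJ n t - 1 * normalJ (-n) t)
      (fun t => Real.cos (n * π) * normalJ' n t - 1 * normalJ' (-n) t)) atTop (𝓝 0) := by
    have h := ((tendsto_wave_normalJ n).const_mul ((Real.cos (n * π) : ℝ) : ℂ)).sub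
      ((tendsto_wave_normalJ (-n)).const_mul ((1 : ℝ) : ℂ))
    rw [besselAmplitude_neg, Real.sin_int_mul_pi] at h
    simp only [Complex.ofReal_zero, zero_mul, add_zero, Complex.ofReal_one, one_mul,
      sub_self] at h
    refine h.congr fun t => ?_
    rw [wave_smul_sub, Complex.ofReal_one, one_mul]
  have h3 := h1.sq_le_of_tendsto_wave h2 hx
  rw [norm_zero, zero_pow two_ne_zero, zero_mul] at h3
  have h4 := pow_eq_zero_iff two_ne_zero |>.1 (le_antisymm h3 (sq_nonneg _))
  simp only [normalJ] at h4
  have h5 : √x * (besselJ n x * Real.cos (n * π) - besselJ (-n) x) = 0 := by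
    linear_combination h4
  exact (mul_eq_zero.1 h5).resolve_left (Real.sqrt_pos.2 hx).ne'

/-- The quotient whose limit in the order defines `besselY`. -/
noncomputable def besselYQuot (μ x : ℝ) : ℝ :=
  (besselJ μ x * Real.cos (μ * π) - besselJ (-μ) x) / Real.sin (μ * π)

theorem sin_mul_pi_ne_zero {ν : ℝ} (hν : ∀ n : ℤ, ν ≠ n) : Real.sin (ν * π) ≠ 0 := by
  rw [Ne, Real.sin_eq_zero_iff]
  rintro ⟨n, hn⟩
  exact hν n (mul_right_cancel₀ Real.pi_ne_zero hn).symm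

theorem tendsto_besselYQuot {x : ℝ} (hx : 0 < x) (ν : ℝ) :
    Tendsto (fun μ => besselYQuot μ x) (𝓝[{μ : ℝ | ∀ n : ℤ, μ ≠ (n : ℝ)}] ν)
      (𝓝 (besselY ν x)) := by
  refine tendsto_nhds_limUnder ?_
  have hJ := differentiable_besselJ_order hx
  have hN : Differentiable ℝ fun μ => besselJ μ x * Real.cos (μ * π) - besselJ (-μ) x := by
    have h2 : Differentiable ℝ fun μ : ℝ => besselJ (-μ) x := hJ.comp differentiable_neg
    fun_prop
  by_cases hν : ∀ n : ℤ, ν ≠ n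
  · exact ⟨_, ((hN ν).continuousAt.div (by fun_prop) (sin_mul_pi_ne_zero hν)).tendsto.mono_left
      nhdsWithin_le_nhds⟩
  · push Not at hν
    obtain ⟨n, rfl⟩ := hν
    have hle : 𝓝[{μ : ℝ | ∀ n : ℤ, μ ≠ (n : ℝ)}] (n : ℝ) ≤ 𝓝[≠] (n : ℝ) :=
      nhdsWithin_mono _ fun μ hμ => hμ n
    have h1 := (hN n).hasDerivAt.tendsto_slope
    have h2 : HasDerivAt (fun μ : ℝ => Real.sin (μ * π)) (Real.cos (n * π) * π) n := by
      simpa using ((hasDerivAt_id (n : ℝ)).mul_const π).sin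
    have h3 : Real.cos (n * π) * π ≠ 0 := by
      rw [Real.cos_int_mul_pi]
      exact mul_ne_zero (zpow_ne_zero _ (by norm_num)) Real.pi_ne_zero
    refine ⟨_, ((h1.div h2.tendsto_slope h3).mono_left hle).congr' ?_⟩
    refine eventually_nhdsWithin_of_forall fun μ hμ => ?_
    have h4 : μ - n ≠ 0 := sub_ne_zero.2 (hμ n)
    have h5 := sin_mul_pi_ne_zero hμ
    simp only [Pi.div_apply, slope_def_field, besselJ_neg_int hx, Real.sin_int_mul_pi, sub_zero,
      besselYQuot]
    field_simp

instance neBot_nhdsWithin_nonintegers (ν : ℝ) :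
    (𝓝[{μ : ℝ | ∀ n : ℤ, μ ≠ (n : ℝ)}] ν).NeBot := by
  rw [← mem_closure_iff_nhdsWithin_neBot]
  have h := (Set.countable_range fun n : ℤ => (n : ℝ)).dense_compl ℝ
  have h2 : (Set.range fun n : ℤ => (n : ℝ))ᶜ = {μ : ℝ | ∀ n : ℤ, μ ≠ (n : ℝ)} := by
    ext μ
    simp [eq_comm]
  rw [← h2]
  exact h ν

/-- The normal form of `besselYQuot`. -/
noncomputable def normalY (ν t : ℝ) : ℝ :=
  Real.cos (ν * π) / Real.sin (ν * π) * normalJ ν t - 1 / Real.sin (ν * π) * normalJ (-ν) t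

/-- The derivative of `normalY`. -/
noncomputable def normalY' (ν t : ℝ) : ℝ :=
  Real.cos (ν * π) / Real.sin (ν * π) * normalJ' ν t - 1 / Real.sin (ν * π) * normalJ' (-ν) t

theorem normalY_eq (ν t : ℝ) : normalY ν t = √t * besselYQuot ν t := by
  simp only [normalY, normalJ, besselYQuot]
  ring

theorem isNormalSol_normalY (ν : ℝ) : IsNormalSol (ν ^ 2 - 1 / 4) (normalY ν) (normalY' ν) :=
  ((isNormalSol_normalJ ν).smul _).sub ((isNormalSol_normalJ_neg ν).smul _)

theorem tendsto_wave_normalY {ν : ℝ} (hν : ∀ n : ℤ, ν ≠ n) :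
    Tendsto (wave (normalY ν) (normalY' ν)) atTop (𝓝 (-Complex.I * besselAmplitude ν)) := by
  have h := ((tendsto_wave_normalJ ν).const_mul
    ((Real.cos (ν * π) / Real.sin (ν * π) : ℝ) : ℂ)).sub
      ((tendsto_wave_normalJ (-ν)).const_mul ((1 / Real.sin (ν * π) : ℝ) : ℂ))
  have hs : (Real.sin (ν * π) : ℂ) ≠ 0 := by exact_mod_cast sin_mul_pi_ne_zero hν
  have h2 : -Complex.I * besselAmplitude ν =
      ((Real.cos (ν * π) / Real.sin (ν * π) : ℝ) : ℂ) * besselAmplitude ν -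
      ((1 / Real.sin (ν * π) : ℝ) : ℂ) * besselAmplitude (-ν) := by
    rw [besselAmplitude_neg, Complex.ofReal_div, Complex.ofReal_div, Complex.ofReal_one]
    field_simp
    ring
  rw [h2]
  exact h.congr fun t => (wave_smul_sub _ _ _ _ _ _ t).symm

theorem continuousOn_besselJ (ν : ℝ) : ContinuousOn (besselJ ν) (Ioi 0) :=
  fun _ ht => (hasDerivAt_besselJ ht ν).continuousAt.continuousWithinAt

theorem tendsto_besselJ_nhdsGT_zero {ν : ℝ} (hν : 0 < ν) :
    Tendsto (besselJ ν) (𝓝[>] 0) (𝓝 0) := by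
  obtain ⟨C, -, hC⟩ := exists_abs_besselJ_le_rpow hν.le
  have h : Tendsto (fun t : ℝ => C * t ^ ν) (𝓝[>] 0) (𝓝 (C * 0 ^ ν)) :=
    ((Real.continuous_rpow_const hν.le).tendsto 0 |>.mono_left nhdsWithin_le_nhds).const_mul C
  rw [Real.zero_rpow hν.ne', mul_zero] at h
  exact squeeze_zero_norm' (eventually_nhdsWithin_of_forall fun t ht => hC t ht) h

theorem tendsto_wronskian_normalJ_nhdsGT_zero {μ ν : ℝ} (hμ : 0 < μ) (hν : 0 < ν) :
    Tendsto (fun t => normalJ' μ t * normalJ ν t - normalJ μ t * normalJ' ν t) (𝓝[>] 0)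
      (𝓝 0) := by
  have h0 : Tendsto (fun t : ℝ => t) (𝓝[>] 0) (𝓝 0) :=
    tendsto_id.mono_left nhdsWithin_le_nhds
  have a := tendsto_besselJ_nhdsGT_zero hμ
  have b := tendsto_besselJ_nhdsGT_zero hν
  have c := tendsto_besselJ_nhdsGT_zero (add_pos hμ one_pos)
  have d := tendsto_besselJ_nhdsGT_zero (add_pos hν one_pos)
  have h := ((a.mul b).const_mul (μ - ν)).add (h0.mul ((a.mul d).sub (c.mul b)))
  simp only [mul_zero, sub_zero, add_zero] at h
  refine h.congr' (eventually_nhdsWithin_of_forall fun t ht => ?_)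
  have ht' : (0 : ℝ) < t := ht
  simp only [normalJ, normalJ']
  field_simp
  rw [Real.sq_sqrt ht'.le]
  ring

theorem integrableOn_Ioo_rpow {s : ℝ} (hs : -1 < s) (z : ℝ) :
    IntegrableOn (fun t : ℝ => t ^ s) (Ioo 0 z) := by
  rcases le_or_gt z 0 with h | h
  · simp [Ioo_eq_empty_of_le h]
  · exact (intervalIntegral.integrableOn_Ioo_rpow_iff h).2 hs

theorem integrableOn_besselJ_mul_besselJ_div {μ ν : ℝ} (hμ : 0 < μ) (hν : 0 < ν) (z : ℝ) :
    IntegrableOn (fun t => besselJ μ t * besselJ ν t / t) (Ioo 0 z) := by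
  obtain ⟨C, hC0, hC⟩ := exists_abs_besselJ_le_rpow hμ.le
  obtain ⟨D, -, hD⟩ := exists_abs_besselJ_le_rpow hν.le
  have hs : -1 < μ + ν - 1 := by linarith
  refine Integrable.mono' ((integrableOn_Ioo_rpow hs z).const_mul (C * D)) ?_ ?_
  · refine ContinuousOn.aestronglyMeasurable ?_ measurableSet_Ioo
    refine ContinuousOn.mono (s := Ioi 0) ?_ fun t ht => ht.1
    exact ((continuousOn_besselJ μ).mul (continuousOn_besselJ ν)).div continuousOn_id
      fun t ht => ne_of_gt ht
  · refine (ae_restrict_iff' measurableSet_Ioo).2 (Eventually.of_forall fun t ht => ?_)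
    have ht' : 0 < t := ht.1
    rw [Real.norm_eq_abs, abs_div, abs_mul, abs_of_pos ht', div_le_iff₀ ht',
      Real.rpow_sub_one ht'.ne', Real.rpow_add ht']
    calc |besselJ μ t| * |besselJ ν t| ≤ (C * t ^ μ) * (D * t ^ ν) := by
          gcongr
          · exact hC t ht'
          · exact hD t ht'
      _ = _ := by field_simp

theorem integral_besselJ_mul_besselJ_div {μ ν z : ℝ} (hμ : 0 < μ) (hν : 0 < ν) (hz : 0 < z) :
    (μ ^ 2 - ν ^ 2) * ∫ t in Ioo 0 z, besselJ μ t * besselJ ν t / t =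
      normalJ' μ z * normalJ ν z - normalJ μ z * normalJ' ν z := by
  have hd : ∀ t, 0 < t → HasDerivAt
      (fun t => normalJ' μ t * normalJ ν t - normalJ μ t * normalJ' ν t)
      ((μ ^ 2 - ν ^ 2) * (besselJ μ t * besselJ ν t / t)) t := fun t ht => by
    refine ((isNormalSol_normalJ μ).hasDerivAt_wronskian (isNormalSol_normalJ ν) ht).congr_deriv ?_
    simp only [normalJ]
    field_simp
    rw [Real.sq_sqrt ht.le]
    ring
  have hi : IntervalIntegrable (fun t => (μ ^ 2 - ν ^ 2) * (besselJ μ t * besselJ ν t / t))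
      volume 0 z := by
    rw [intervalIntegrable_iff_integrableOn_Ioo_of_le hz.le]
    exact (integrableOn_besselJ_mul_besselJ_div hμ hν z).const_mul _
  have h := intervalIntegral.integral_eq_sub_of_hasDerivAt_of_tendsto hz
    (fun t ht => hd t ht.1) hi (tendsto_wronskian_normalJ_nhdsGT_zero hμ hν)
    ((hd z hz).continuousAt.tendsto.mono_left nhdsWithin_le_nhds)
  rw [sub_zero, intervalIntegral.integral_of_le hz.le, integral_Ioc_eq_integral_Ioo,
    integral_const_mul] at h
  exact h

theorem abs_le_exp_of_tendsto_wave {ν : ℝ} {u u' : ℝ → ℝ} (hu : IsNormalSol (ν ^ 2 - 1 / 4) u u')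
    {w : ℂ} (hw : Tendsto (wave u u') atTop (𝓝 w)) (hw1 : ‖w‖ ^ 2 = 2 / π) {R z t : ℝ}
    (hR : |ν| ≤ R) (hz : 0 < z) (ht : z ≤ t) : |u t| ≤ Real.exp ((R ^ 2 + 1) / z) := by
  have ht0 : 0 < t := hz.trans_le ht
  have h1 := hu.sq_le_of_tendsto_wave hw ht0
  have h2 : 2 / π ≤ 1 := (div_le_one Real.pi_pos).2 (by linarith [Real.pi_gt_three])
  have hν : ν ^ 2 ≤ R ^ 2 := sq_le_sq' (by linarith [neg_abs_le ν]) ((le_abs_self ν).trans hR)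
  have h3 : |ν ^ 2 - 1 / 4| ≤ R ^ 2 + 1 :=
    abs_le.2 ⟨by linarith [sq_nonneg ν, sq_nonneg R], by linarith⟩
  have h4 : |ν ^ 2 - 1 / 4| / t ≤ (R ^ 2 + 1) / z := by gcongr
  have h5 : 1 ≤ Real.exp ((R ^ 2 + 1) / z) := Real.one_le_exp (by positivity)
  refine abs_le_of_sq_le_sq ?_ (Real.exp_pos _).le
  calc u t ^ 2 ≤ 2 / π * Real.exp (|ν ^ 2 - 1 / 4| / t) := by rw [← hw1]; exact h1
    _ ≤ 1 * Real.exp ((R ^ 2 + 1) / z) := by gcongr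
    _ ≤ Real.exp ((R ^ 2 + 1) / z) ^ 2 := by nlinarith

theorem abs_normalJ_le_exp {ν R z t : ℝ} (hR : |ν| ≤ R) (hz : 0 < z) (ht : z ≤ t) :
    |normalJ ν t| ≤ Real.exp ((R ^ 2 + 1) / z) :=
  abs_le_exp_of_tendsto_wave (isNormalSol_normalJ ν) (tendsto_wave_normalJ ν)
    (normSq_besselAmplitude ν) hR hz ht

theorem abs_normalY_le_exp {ν R z t : ℝ} (hν : ∀ n : ℤ, ν ≠ n) (hR : |ν| ≤ R) (hz : 0 < z)
    (ht : z ≤ t) : |normalY ν t| ≤ Real.exp ((R ^ 2 + 1) / z) := by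
  refine abs_le_exp_of_tendsto_wave (isNormalSol_normalY ν) (tendsto_wave_normalY hν) ?_ hR hz ht
  rw [norm_mul, norm_neg, Complex.norm_I, one_mul, normSq_besselAmplitude]

theorem integrableOn_Ioi_const_div_sq {z : ℝ} (hz : 0 < z) (K : ℝ) :
    IntegrableOn (fun t : ℝ => K / t ^ 2) (Ioi z) := by
  have h := (integrableOn_Ioi_rpow_of_lt (by norm_num : (-2 : ℝ) < -1) hz).const_mul K
  refine IntegrableOn.congr_fun h (fun t ht => ?_) measurableSet_Ioi
  have ht' : 0 < t := hz.trans ht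
  simp only [Real.rpow_neg ht'.le, Real.rpow_two, div_eq_mul_inv]

theorem abs_besselJ_mul_div_le {μ R z t y M : ℝ} (hR : |μ| ≤ R) (hz : 0 < z) (ht : z ≤ t)
    (hy : |√t * y| ≤ M) :
    |besselJ μ t * y / t| ≤ Real.exp ((R ^ 2 + 1) / z) * M / t ^ 2 := by
  have ht0 : 0 < t := hz.trans_le ht
  have h : besselJ μ t * y / t = normalJ μ t * (√t * y) / t ^ 2 := by
    rw [normalJ]
    field_simp
    rw [Real.sq_sqrt ht0.le]
  rw [h, abs_div, abs_mul, abs_of_pos (by positivity : 0 < t ^ 2)]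
  gcongr
  exact abs_normalJ_le_exp hR hz ht

theorem continuousOn_besselYQuot (ν : ℝ) : ContinuousOn (besselYQuot ν) (Ioi 0) :=
  (((continuousOn_besselJ ν).mul continuousOn_const).sub (continuousOn_besselJ (-ν))).div_const _

theorem integral_besselJ_mul_besselYQuot_div {μ ν z : ℝ} (hν : ∀ n : ℤ, ν ≠ n) (hz : 0 < z) :
    (μ ^ 2 - ν ^ 2) * ∫ t in Ioi z, besselJ μ t * besselYQuot ν t / t =
      -(2 / π * Real.cos ((μ - ν) * π / 2)) -
        (normalJ' μ z * normalY ν z - normalJ μ z * normalY' ν z) := by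
  have hd : ∀ t, 0 < t → HasDerivAt
      (fun t => normalJ' μ t * normalY ν t - normalJ μ t * normalY' ν t)
      ((μ ^ 2 - ν ^ 2) * (besselJ μ t * besselYQuot ν t / t)) t := fun t ht => by
    refine ((isNormalSol_normalJ μ).hasDerivAt_wronskian (isNormalSol_normalY ν) ht).congr_deriv ?_
    simp only [normalJ, normalY_eq]
    field_simp
    rw [Real.sq_sqrt ht.le]
    ring
  have hi : IntegrableOn (fun t => besselJ μ t * besselYQuot ν t / t) (Ioi z) := by
    refine Integrable.mono' (integrableOn_Ioi_const_div_sq hz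
      (Real.exp ((|μ| ^ 2 + 1) / z) * Real.exp ((|ν| ^ 2 + 1) / z))) ?_ ?_
    · refine ContinuousOn.aestronglyMeasurable ?_ measurableSet_Ioi
      refine ContinuousOn.mono (s := Ioi 0) ?_ fun t ht => hz.trans ht
      exact ((continuousOn_besselJ μ).mul (continuousOn_besselYQuot ν)).div continuousOn_id
        fun t ht => ne_of_gt ht
    · refine (ae_restrict_iff' measurableSet_Ioi).2 (Eventually.of_forall fun t ht => ?_)
      have ht' : z ≤ t := le_of_lt ht
      refine abs_besselJ_mul_div_le le_rfl hz ht' ?_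
      rw [← normalY_eq]
      exact abs_normalY_le_exp hν le_rfl hz ht'
  have h := integral_Ioi_of_hasDerivAt_of_tendsto (hd z hz).continuousAt.continuousWithinAt
    (fun t ht => hd t (hz.trans ht)) (hi.const_mul _)
    (IsNormalSol.tendsto_wronskian (tendsto_wave_normalJ μ) (tendsto_wave_normalY hν))
  rw [integral_const_mul] at h
  rw [h, ← conj_besselAmplitude_mul_re]
  simp [add_comm]

theorem wronskian_normalJ_normalY {ν z : ℝ} (hν : ∀ n : ℤ, ν ≠ n) (hz : 0 < z) :
    normalJ ν z * normalY' ν z - normalJ' ν z * normalY ν z = 2 / π := by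
  have h := integral_besselJ_mul_besselYQuot_div (μ := ν) hν hz
  rw [sub_self, zero_mul, sub_self, zero_mul, zero_div, Real.cos_zero] at h
  linarith

theorem besselJ_sub_cos_mul {μ ν z : ℝ} (hμ : 0 < μ) (hν0 : 0 < ν) (hν : ∀ n : ℤ, ν ≠ n)
    (hz : 0 < z) :
    besselJ μ z - Real.cos ((μ - ν) * π / 2) * besselJ ν z = π / 2 * (μ ^ 2 - ν ^ 2) *
      (besselYQuot ν z * (∫ t in Ioo 0 z, besselJ μ t * besselJ ν t / t) +
        besselJ ν z * ∫ t in Ioi z, besselJ μ t * besselYQuot ν t / t) := by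
  have h1 := integral_besselJ_mul_besselJ_div hμ hν0 hz
  have h2 := integral_besselJ_mul_besselYQuot_div (μ := μ) hν hz
  have h3 := wronskian_normalJ_normalY hν hz
  have hs : √z ≠ 0 := (Real.sqrt_pos.2 hz).ne'
  have hp : π * (2 / π) = 2 := by field_simp
  have h4 : normalJ μ z * (2 / π) = 2 / π * Real.cos ((μ - ν) * π / 2) * normalJ ν z +
      (μ ^ 2 - ν ^ 2) * (normalY ν z * (∫ t in Ioo 0 z, besselJ μ t * besselJ ν t / t) +
        normalJ ν z * ∫ t in Ioi z, besselJ μ t * besselYQuot ν t / t) := by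
    linear_combination (-normalJ μ z) * h3 - normalY ν z * h1 - normalJ ν z * h2
  refine mul_left_cancel₀ hs ?_
  rw [normalY_eq] at h4
  simp only [normalJ] at h4
  linear_combination π / 2 * h4 - (√z * besselJ μ z / 2 -
    Real.cos ((μ - ν) * π / 2) * (√z * besselJ ν z) / 2) * hp

theorem exists_eventually_abs_besselJ_le {α : ℝ} (hα : 0 < α) (z : ℝ) :
    ∃ C, 0 ≤ C ∧ ∀ᶠ μ in 𝓝 α, ∀ t ∈ Ioo 0 z, |besselJ μ t| ≤ C * t ^ (α / 2) := by
  obtain ⟨C, hC0, hC⟩ := exists_abs_besselJ_le (α + 1) z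
  refine ⟨C * max z 1 ^ (α + 1), by positivity, ?_⟩
  filter_upwards [Ioo_mem_nhds (by linarith : α / 2 < α) (by linarith : α < α + 1)] with μ hμ t ht
  have h1 : |μ| ≤ α + 1 := abs_le.2 ⟨by linarith [hμ.1], hμ.2.le⟩
  have h2 : t ^ (μ - α / 2) ≤ max z 1 ^ (α + 1) :=
    (Real.rpow_le_rpow ht.1.le (ht.2.le.trans (le_max_left _ _)) (by linarith [hμ.1])).trans
      (Real.rpow_le_rpow_of_exponent_le (le_max_right _ _) (by linarith [hμ.2]))
  calc |besselJ μ t| ≤ C * t ^ μ := hC μ t h1 ht.1 ht.2.le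
    _ = C * t ^ (μ - α / 2) * t ^ (α / 2) := by
      rw [mul_assoc, ← Real.rpow_add ht.1, sub_add_cancel]
    _ ≤ C * max z 1 ^ (α + 1) * t ^ (α / 2) := by
      have := Real.rpow_nonneg ht.1.le (α / 2)
      gcongr

theorem tendsto_integral_besselJ_mul_besselJ_div {l : Filter ℝ} [l.IsCountablyGenerated]
    {a b : ℝ → ℝ} {α β : ℝ} (hα : 0 < α) (hβ : 0 < β) (ha : Tendsto a l (𝓝 α))
    (hb : Tendsto b l (𝓝 β)) (z : ℝ) :
    Tendsto (fun i => ∫ t in Ioo 0 z, besselJ (a i) t * besselJ (b i) t / t) l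
      (𝓝 (∫ t in Ioo 0 z, besselJ α t * besselJ β t / t)) := by
  obtain ⟨C, hC0, hC⟩ := exists_eventually_abs_besselJ_le hα z
  obtain ⟨D, -, hD⟩ := exists_eventually_abs_besselJ_le hβ z
  have hs : -1 < α / 2 + β / 2 - 1 := by linarith
  refine tendsto_integral_filter_of_dominated_convergence
    (fun t => C * D * t ^ (α / 2 + β / 2 - 1)) ?_ ?_ ((integrableOn_Ioo_rpow hs z).const_mul _) ?_
  · filter_upwards [ha.eventually_const_lt hα, hb.eventually_const_lt hβ] with i h1 h2
    exact (integrableOn_besselJ_mul_besselJ_div h1 h2 z).aestronglyMeasurable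
  · filter_upwards [ha.eventually hC, hb.eventually hD] with i h1 h2
    refine (ae_restrict_iff' measurableSet_Ioo).2 (Eventually.of_forall fun t ht => ?_)
    have ht' : 0 < t := ht.1
    rw [Real.norm_eq_abs, abs_div, abs_mul, abs_of_pos ht', div_le_iff₀ ht',
      Real.rpow_sub_one ht'.ne', Real.rpow_add ht']
    calc |besselJ (a i) t| * |besselJ (b i) t| ≤ (C * t ^ (α / 2)) * (D * t ^ (β / 2)) := by
          gcongr
          · exact h1 t ht
          · exact h2 t ht
      _ = _ := by field_simp
  · refine (ae_restrict_iff' measurableSet_Ioo).2 (Eventually.of_forall fun t ht => ?_)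
    have hJ := (differentiable_besselJ_order ht.1).continuous
    exact (((hJ.tendsto α).comp ha).mul ((hJ.tendsto β).comp hb)).div_const t

theorem tendsto_integral_besselJ_mul_div {l : Filter ℝ} [l.IsCountablyGenerated]
    {a : ℝ → ℝ} {α : ℝ} (ha : Tendsto a l (𝓝 α)) {z M : ℝ} (hz : 0 < z) {f : ℝ → ℝ → ℝ}
    {g : ℝ → ℝ} (hfm : ∀ᶠ i in l, AEStronglyMeasurable (f i) (volume.restrict (Ioi z)))
    (hfM : ∀ᶠ i in l, ∀ t, z ≤ t → |√t * f i t| ≤ M)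
    (hfg : ∀ t, z ≤ t → Tendsto (fun i => f i t) l (𝓝 (g t))) :
    Tendsto (fun i => ∫ t in Ioi z, besselJ (a i) t * f i t / t) l
      (𝓝 (∫ t in Ioi z, besselJ α t * g t / t)) := by
  refine tendsto_integral_filter_of_dominated_convergence
    (fun t => Real.exp (((|α| + 1) ^ 2 + 1) / z) * M / t ^ 2) ?_ ?_
    (integrableOn_Ioi_const_div_sq hz _) ?_
  · filter_upwards [hfm] with i h
    refine ((ContinuousOn.aestronglyMeasurable ?_ measurableSet_Ioi).mul h).div₀
      measurable_id.aestronglyMeasurable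
    exact (continuousOn_besselJ _).mono fun t ht => hz.trans ht
  · filter_upwards [hfM, ha.abs.eventually_le_const (lt_add_one |α|)] with i h1 h2
    refine (ae_restrict_iff' measurableSet_Ioi).2 (Eventually.of_forall fun t ht => ?_)
    exact abs_besselJ_mul_div_le h2 hz (le_of_lt ht) (h1 t (le_of_lt ht))
  · refine (ae_restrict_iff' measurableSet_Ioi).2 (Eventually.of_forall fun t ht => ?_)
    have hJ := (differentiable_besselJ_order (hz.trans ht)).continuous
    exact (((hJ.tendsto α).comp ha).mul (hfg t (le_of_lt ht))).div_const t

theorem eventually_abs_sqrt_mul_besselYQuot_le (ν : ℝ) {z : ℝ} (hz : 0 < z) :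
    ∀ᶠ μ in 𝓝[{μ : ℝ | ∀ n : ℤ, μ ≠ (n : ℝ)}] ν, ∀ t, z ≤ t →
      |√t * besselYQuot μ t| ≤ Real.exp (((|ν| + 1) ^ 2 + 1) / z) := by
  have h1 : ∀ᶠ μ in 𝓝 ν, |μ| ≤ |ν| + 1 :=
    (continuous_abs.tendsto ν).eventually_le_const (lt_add_one |ν|)
  filter_upwards [self_mem_nhdsWithin, nhdsWithin_le_nhds h1] with μ hμ hμ' t ht
  rw [← normalY_eq]
  exact abs_normalY_le_exp hμ hμ' hz ht

theorem abs_sqrt_mul_besselY_le (ν : ℝ) {z t : ℝ} (hz : 0 < z) (ht : z ≤ t) :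
    |√t * besselY ν t| ≤ Real.exp (((|ν| + 1) ^ 2 + 1) / z) :=
  le_of_tendsto ((tendsto_besselYQuot (hz.trans_le ht) ν).const_mul √t).abs
    ((eventually_abs_sqrt_mul_besselYQuot_le ν hz).mono fun _ h => h t ht)

theorem aestronglyMeasurable_besselYQuot (ν : ℝ) {z : ℝ} (hz : 0 < z) :
    AEStronglyMeasurable (besselYQuot ν) (volume.restrict (Ioi z)) :=
  ((continuousOn_besselYQuot ν).mono fun _ ht => hz.trans ht).aestronglyMeasurable measurableSet_Ioi

theorem aestronglyMeasurable_besselY (ν : ℝ) {z : ℝ} (hz : 0 < z) :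
    AEStronglyMeasurable (besselY ν) (volume.restrict (Ioi z)) :=
  aestronglyMeasurable_of_tendsto_ae (𝓝[{μ : ℝ | ∀ n : ℤ, μ ≠ (n : ℝ)}] ν)
    (fun μ => aestronglyMeasurable_besselYQuot μ hz)
    ((ae_restrict_iff' measurableSet_Ioi).2 (Eventually.of_forall fun _ ht =>
      tendsto_besselYQuot (hz.trans ht) ν))

theorem besselJ_sub_cos_mul_besselJ {μ ν z : ℝ} (hμ : 0 < μ) (hν : 0 < ν) (hz : 0 < z) :
    besselJ μ z - Real.cos ((μ - ν) * π / 2) * besselJ ν z = π / 2 * (μ ^ 2 - ν ^ 2) *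
      (besselY ν z * (∫ t in Ioo 0 z, besselJ μ t * besselJ ν t / t) +
        besselJ ν z * ∫ t in Ioi z, besselJ μ t * besselY ν t / t) := by
  set l := 𝓝[{μ : ℝ | ∀ n : ℤ, μ ≠ (n : ℝ)}] ν with hl
  have hid : Tendsto (fun i : ℝ => i) l (𝓝 ν) := tendsto_id.mono_left nhdsWithin_le_nhds
  have hJ : Tendsto (fun i => besselJ i z) l (𝓝 (besselJ ν z)) :=
    ((differentiable_besselJ_order hz).continuous.tendsto ν).comp hid
  have hA := tendsto_integral_besselJ_mul_besselJ_div hμ hν tendsto_const_nhds hid z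
  have hB := tendsto_integral_besselJ_mul_div (tendsto_const_nhds (x := μ)) hz
    (Eventually.of_forall fun i => aestronglyMeasurable_besselYQuot i hz)
    (eventually_abs_sqrt_mul_besselYQuot_le ν hz)
    (fun t ht => tendsto_besselYQuot (hz.trans_le ht) ν)
  have hcos : Tendsto (fun i => Real.cos ((μ - i) * π / 2)) l (𝓝 (Real.cos ((μ - ν) * π / 2))) :=
    ((by fun_prop : Continuous fun i => Real.cos ((μ - i) * π / 2)).tendsto ν).comp hid
  have hsq : Tendsto (fun i => π / 2 * (μ ^ 2 - i ^ 2)) l (𝓝 (π / 2 * (μ ^ 2 - ν ^ 2))) :=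
    ((by fun_prop : Continuous fun i => π / 2 * (μ ^ 2 - i ^ 2)).tendsto ν).comp hid
  have hL := (hcos.mul hJ).const_sub (besselJ μ z)
  have hR := hsq.mul (((tendsto_besselYQuot hz ν).mul hA).add (hJ.mul hB))
  refine tendsto_nhds_unique (hL.congr' ?_) hR
  filter_upwards [self_mem_nhdsWithin, hid.eventually_const_lt hν] with i h1 h2
  exact besselJ_sub_cos_mul hμ h2 h1 hz

theorem hasDerivAt_besselJ_order {ν z : ℝ} (hν : 0 < ν) (hz : 0 < z) :
    HasDerivAt (fun μ => besselJ μ z)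
      (π * ν * (besselY ν z * (∫ t in Ioo 0 z, besselJ ν t * besselJ ν t / t) +
        besselJ ν z * ∫ t in Ioi z, besselJ ν t * besselY ν t / t)) ν := by
  have hid : Tendsto (fun i : ℝ => i) (𝓝[≠] ν) (𝓝 ν) := tendsto_id.mono_left nhdsWithin_le_nhds
  have hA := tendsto_integral_besselJ_mul_besselJ_div hν hν hid tendsto_const_nhds z
  have hB := tendsto_integral_besselJ_mul_div hid hz
    (Eventually.of_forall fun _ => aestronglyMeasurable_besselY ν hz)
    (Eventually.of_forall fun _ t ht => abs_sqrt_mul_besselY_le ν hz ht)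
    (fun t _ => tendsto_const_nhds (x := besselY ν t))
  have hcos : HasDerivAt (fun μ => Real.cos ((μ - ν) * π / 2)) 0 ν := by
    have h := ((((hasDerivAt_id ν).sub_const ν).mul_const π).div_const 2).cos
    simpa using h
  have hsum : Tendsto (fun i => π / 2 * (i + ν)) (𝓝[≠] ν) (𝓝 (π / 2 * (ν + ν))) :=
    (hid.add_const ν).const_mul _
  have h := (hcos.tendsto_slope.mul_const (besselJ ν z)).add
    (hsum.mul ((hA.const_mul (besselY ν z)).add (hB.const_mul (besselJ ν z))))
  rw [zero_mul, zero_add, show π / 2 * (ν + ν) = π * ν by ring] at h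
  rw [hasDerivAt_iff_tendsto_slope]
  refine h.congr' ?_
  filter_upwards [self_mem_nhdsWithin, hid.eventually_const_lt hν] with μ h1 h2
  have h3 := besselJ_sub_cos_mul_besselJ h2 hν hz
  have h4 : μ - ν ≠ 0 := sub_ne_zero.2 h1
  rw [slope_def_field, slope_def_field, sub_self, zero_mul, zero_div, Real.cos_zero]
  rw [eq_div_iff h4, add_mul, mul_right_comm, div_mul_cancel₀ _ h4]
  linear_combination -h3

theorem stmt2 (ν z : ℝ) (hν : 0 < ν) (hz : 0 < z) :
    deriv (fun μ => besselJ μ z) ν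
      = ν * Real.pi * besselY ν z * (∫ t in Set.Ioo (0:ℝ) z, besselJ ν t ^ 2 / t)
        + ν * Real.pi * besselJ ν z * (∫ t in Set.Ioi z, besselJ ν t * besselY ν t / t) := by
  rw [(hasDerivAt_besselJ_order hν hz).deriv]
  simp only [sq]
  ring
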